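/- arXiv:0905.1685 — 6 statements merged into one kernel-verified Lean document; each statement's English description precedes it below -/
import Mathlib

section
/- Let u be a viscosity solution of λ (det D²u)^p ≤ u_t ≤ Λ (det D²u)^p in Ω × [−T,0] with 0 ∈ Ω and u(0,0) = 0, and set C₀ = 100. Let 0 < δ ≤ 1, d ≥ 1, t₀ ∈ (0,T], h > 0 and α > 0, and assume: (i) (h, α) ∈ A_{−t₀}(u) while (C₀ h, (1+δ) α) ∉ A_{−t₀}(u); (ii) there exists q ∈ ℝⁿ such that the section S_h := {x ∈ Ω : u(x,−t₀) < h + q·x} is d-balanced with respect to 0 and has compact closure contained in Ω. Then there exists c(d) > 0, depending only on d, n, p, λ, Λ, such that (C₀² h, α/(1 + δ/2)) ∈ A_{−t}(u) for every t with t₀ ≤ t ≤ min(T, t₀ + c(d) δ^{−2p} t₀). -/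
open Set Metric MeasureTheory
open scoped RealInnerProductSpace

noncomputable section

abbrev E (n : ℕ) := EuclideanSpace ℝ (Fin n)

variable {n : ℕ}

/-- The time derivative `∂ₜφ(x,t)`. -/
noncomputable def timeDeriv (φ : E n → ℝ → ℝ) (x : E n) (t : ℝ) : ℝ :=
  deriv (φ x) t

/-- The spatial Hessian matrix `D²φ(x,t)` (in the standard coordinates). -/
noncomputable def hessMatrix (φ : E n → ℝ → ℝ) (x : E n) (t : ℝ) :
    Matrix (Fin n) (Fin n) ℝ :=
  Matrix.of fun i j =>
    fderiv ℝ (fun y => fderiv ℝ (fun z => φ z t) y (EuclideanSpace.single j (1:ℝ))) x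
      (EuclideanSpace.single i (1:ℝ))

/-- `φ` is an admissible test function near `(x₀,t₀)`: C² in `x` and C¹ in `t` nearby. -/
def IsTestAt (φ : E n → ℝ → ℝ) (x₀ : E n) (t₀ : ℝ) : Prop :=
  ∃ ε > (0:ℝ),
    (∀ t ∈ ball t₀ ε, ContDiffOn ℝ 2 (fun x => φ x t) (ball x₀ ε)) ∧
    (∀ x ∈ ball x₀ ε, ContDiffOn ℝ 1 (fun t => φ x t) (ball t₀ ε))

/-- `u - φ` attains a local maximum at `(x₀,t₀)` among times `t ≤ t₀`,
relative to `closure Ω × [t₁,t₂]`. -/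
def LocalMaxBelow (Ω : Set (E n)) (t₁ t₂ : ℝ) (u φ : E n → ℝ → ℝ)
    (x₀ : E n) (t₀ : ℝ) : Prop :=
  ∃ ε > (0:ℝ), ∀ x ∈ closure Ω, ∀ t ∈ Icc t₁ t₂, t ≤ t₀ →
    dist x x₀ < ε → dist t t₀ < ε →
    u x t - φ x t ≤ u x₀ t₀ - φ x₀ t₀

/-- `u - φ` attains a local minimum at `(x₀,t₀)` among times `t ≤ t₀`. -/
def LocalMinBelow (Ω : Set (E n)) (t₁ t₂ : ℝ) (u φ : E n → ℝ → ℝ)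
    (x₀ : E n) (t₀ : ℝ) : Prop :=
  ∃ ε > (0:ℝ), ∀ x ∈ closure Ω, ∀ t ∈ Icc t₁ t₂, t ≤ t₀ →
    dist x x₀ < ε → dist t t₀ < ε →
    u x₀ t₀ - φ x₀ t₀ ≤ u x t - φ x t

/-- Viscosity subsolution of `u_t ≤ Λ (det D²u)^p` on `Ω × [t₁,t₂]`. -/
def ViscSubsolution (Lam p : ℝ) (Ω : Set (E n)) (t₁ t₂ : ℝ) (u : E n → ℝ → ℝ) : Prop :=
  ∀ x₀ ∈ Ω, ∀ t₀ ∈ Ioc t₁ t₂, ∀ φ : E n → ℝ → ℝ, IsTestAt φ x₀ t₀ →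
    LocalMaxBelow Ω t₁ t₂ u φ x₀ t₀ →
    timeDeriv φ x₀ t₀ ≤ Lam * max (hessMatrix φ x₀ t₀).det 0 ^ p

/-- Viscosity supersolution of `u_t ≥ λ (det D²u)^p` on `Ω × [t₁,t₂]`. -/
def ViscSupersolution (lam p : ℝ) (Ω : Set (E n)) (t₁ t₂ : ℝ) (u : E n → ℝ → ℝ) : Prop :=
  ∀ x₀ ∈ Ω, ∀ t₀ ∈ Ioc t₁ t₂, ∀ φ : E n → ℝ → ℝ, IsTestAt φ x₀ t₀ →
    LocalMinBelow Ω t₁ t₂ u φ x₀ t₀ →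
    (hessMatrix φ x₀ t₀).PosSemidef →
    lam * (hessMatrix φ x₀ t₀).det ^ p ≤ timeDeriv φ x₀ t₀

/-- The regularity/structure assumptions: continuity on `closure Ω × [t₁,t₂]`,
convexity in `x`, monotonicity in `t`. -/
structure ParabolicRegular (Ω : Set (E n)) (t₁ t₂ : ℝ) (u : E n → ℝ → ℝ) : Prop where
  cont : ContinuousOn (fun q : E n × ℝ => u q.1 q.2) (closure Ω ×ˢ Icc t₁ t₂)
  conv : ∀ t ∈ Icc t₁ t₂, ConvexOn ℝ (closure Ω) (fun x => u x t)
  mono : ∀ x ∈ closure Ω, ∀ s ∈ Icc t₁ t₂, ∀ t ∈ Icc t₁ t₂, s ≤ t → u x s ≤ u x t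

/-- Viscosity solution of `λ (det D²u)^p ≤ u_t ≤ Λ (det D²u)^p` on `Ω × [t₁,t₂]`. -/
def ViscositySolution (lam Lam p : ℝ) (Ω : Set (E n)) (t₁ t₂ : ℝ) (u : E n → ℝ → ℝ) : Prop :=
  ParabolicRegular Ω t₁ t₂ u ∧ ViscSubsolution Lam p Ω t₁ t₂ u ∧
    ViscSupersolution lam p Ω t₁ t₂ u

/-- `w` is `C^{1,α}` at `x₀` (relative to the set `D`) with some finite constant. -/
def C1AlphaAt (w : E n → ℝ) (D : Set (E n)) (α : ℝ) (x₀ : E n) : Prop :=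
  ∃ C a : ℝ, ∃ q : E n, ∀ x ∈ D, |w x - (a + ⟪q, x - x₀⟫)| ≤ C * ‖x - x₀‖ ^ (1 + α)

/-- `w` is `C^{1,α}` at `x₀` in the direction `e` (relative to the set `D`). -/
def C1AlphaDirAt (w : E n → ℝ) (D : Set (E n)) (α : ℝ) (x₀ e : E n) : Prop :=
  ∃ C a q : ℝ, ∀ s : ℝ, x₀ + s • e ∈ D →
    |w (x₀ + s • e) - (a + q * s)| ≤ C * |s| ^ (1 + α)

/-- A convex set `S` is `d`-balanced with respect to `x₀`. -/
def DBalanced (d : ℝ) (S : Set (E n)) (x₀ : E n) : Prop :=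
  ∃ A : E n →ₗ[ℝ] E n, Function.Bijective A ∧
    ball (0 : E n) 1 ⊆ A '' ((fun y => y - x₀) '' S) ∧
    A '' ((fun y => y - x₀) '' S) ⊆ ball (0 : E n) d

/-- `x₀` is an extremal point of the convex set `D`. -/
def ExtremalPoint (D : Set (E n)) (x₀ : E n) : Prop :=
  ¬ ∃ y ∈ closure D, ∃ z ∈ closure D, ∃ t : ℝ,
      0 < t ∧ t < 1 ∧ y ≠ z ∧ x₀ = t • y + (1 - t) • z

/-- The set `A_t(u)`: `(h, a) ∈ A_t(u)` iff some angle of opening `a` in the direction `e`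
with vertex at height `u(0,0) - h` lies below the graph of `u(·,t)`. -/
def AngleSet {n : ℕ} (Ω : Set (E n)) (u : E n → ℝ → ℝ) (e : E n) (t h a : ℝ) : Prop :=
  ∃ q₁ q₂ : E n, a ≤ ⟪q₁ - q₂, e⟫ ∧
    ∀ x ∈ Ω, u 0 0 - h + max ⟪q₁, x⟫ ⟪q₂, x⟫ ≤ u x t

/-- The paraboloid `a + ρ t + ℓ(x) + (k/2) |N (x - z)|²` moving upwards at constant speed `ρ`. -/
def movingParaboloid (N : E n →L[ℝ] E n) (ℓ : E n →L[ℝ] ℝ) (z : E n) (a ρ k : ℝ) :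
    E n → ℝ → ℝ :=
  fun x t => a + ρ * t + ℓ x + k / 2 * ‖N (x - z)‖ ^ 2

namespace movingParaboloid

variable (N : E n →L[ℝ] E n) (ℓ : E n →L[ℝ] ℝ) (z : E n) (a ρ k : ℝ)

lemma isTestAt (x₀ : E n) (t₀ : ℝ) : IsTestAt (movingParaboloid N ℓ z a ρ k) x₀ t₀ := by
  refine ⟨1, one_pos, fun t _ => ContDiff.contDiffOn ?_, fun x _ => ContDiff.contDiffOn ?_⟩
  · unfold movingParaboloid
    exact ((contDiff_const.add ℓ.contDiff)).add
      (contDiff_const.mul ((N.contDiff.comp (contDiff_id.sub contDiff_const)).norm_sq ℝ))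
  · unfold movingParaboloid
    fun_prop

lemma continuous_uncurry :
    Continuous (fun q : E n × ℝ => movingParaboloid N ℓ z a ρ k q.1 q.2) := by
  unfold movingParaboloid
  fun_prop

lemma timeDeriv_eq (x₀ : E n) (t₀ : ℝ) :
    timeDeriv (movingParaboloid N ℓ z a ρ k) x₀ t₀ = ρ := by
  have h : HasDerivAt (movingParaboloid N ℓ z a ρ k x₀) ρ t₀ := by
    unfold movingParaboloid
    simpa using ((((hasDerivAt_id t₀).const_mul ρ).const_add a).add_const (ℓ x₀)).add_const
      (k / 2 * ‖N (x₀ - z)‖ ^ 2)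
  exact h.deriv

lemma hessMatrix_eq (x₀ : E n) (t₀ : ℝ) :
    hessMatrix (movingParaboloid N ℓ z a ρ k) x₀ t₀ =
      k • ((LinearMap.toMatrixOrthonormal (EuclideanSpace.basisFun (Fin n) ℝ)
        (N : E n →ₗ[ℝ] E n)).conjTranspose *
        LinearMap.toMatrixOrthonormal (EuclideanSpace.basisFun (Fin n) ℝ)
        (N : E n →ₗ[ℝ] E n)) := by
  have h1 : ∀ y v : E n, fderiv ℝ (fun x => movingParaboloid N ℓ z a ρ k x t₀) y v =
      ℓ v + k * ⟪N (y - z), N v⟫ := by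
    intro y v
    have hN : HasFDerivAt (fun x => N (x - z)) N y :=
      N.hasFDerivAt.comp y ((hasFDerivAt_id y).sub_const z)
    have := ((ℓ.hasFDerivAt (x := y)).const_add (a + ρ * t₀)).add
      (hN.norm_sq.const_mul (k / 2))
    have h2 : HasFDerivAt (fun x => movingParaboloid N ℓ z a ρ k x t₀) _ y := this
    rw [h2.fderiv]
    simp [-map_sub]
    ring
  ext i j
  have h3 : fderiv ℝ (fun y => ℓ (EuclideanSpace.single j 1) +
      k * ⟪N (y - z), N (EuclideanSpace.single j 1)⟫) x₀ (EuclideanSpace.single i 1) =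
      k * ⟪N (EuclideanSpace.single i 1), N (EuclideanSpace.single j 1)⟫ := by
    have hN : HasFDerivAt (fun x => N (x - z)) N x₀ :=
      N.hasFDerivAt.comp x₀ ((hasFDerivAt_id x₀).sub_const z)
    have := ((hN.inner ℝ (hasFDerivAt_const (N (EuclideanSpace.single j (1:ℝ))) x₀)).const_mul
      k).const_add (ℓ (EuclideanSpace.single j 1))
    rw [this.fderiv]
    simp
  rw [hessMatrix, Matrix.of_apply]
  simp_rw [h1]
  rw [h3, Matrix.smul_apply, Matrix.mul_apply]
  simp only [Matrix.conjTranspose_apply, LinearMap.toMatrixOrthonormal_apply_apply, star_trivial,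
    EuclideanSpace.basisFun_apply, ContinuousLinearMap.coe_coe, smul_eq_mul]
  rw [← (EuclideanSpace.basisFun (Fin n) ℝ).sum_inner_mul_inner]
  simp only [EuclideanSpace.basisFun_apply, real_inner_comm]

lemma det_hessMatrix (x₀ : E n) (t₀ : ℝ) :
    (hessMatrix (movingParaboloid N ℓ z a ρ k) x₀ t₀).det =
      k ^ n * LinearMap.det (N : E n →ₗ[ℝ] E n) ^ 2 := by
  have h : (LinearMap.toMatrixOrthonormal (EuclideanSpace.basisFun (Fin n) ℝ)
      (N : E n →ₗ[ℝ] E n)).det = LinearMap.det (N : E n →ₗ[ℝ] E n) :=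
    LinearMap.det_toMatrix _ _
  rw [hessMatrix_eq, Matrix.det_smul, Matrix.det_mul, Matrix.det_conjTranspose, h]
  simp [sq]

lemma posSemidef_hessMatrix (hk : 0 ≤ k) (x₀ : E n) (t₀ : ℝ) :
    (hessMatrix (movingParaboloid N ℓ z a ρ k) x₀ t₀).PosSemidef := by
  rw [hessMatrix_eq]
  exact (Matrix.posSemidef_conjTranspose_mul_self _).smul hk

end movingParaboloid

/-- Comparison of a subsolution with a faster moving paraboloid. -/
lemma ViscSubsolution.le_movingParaboloid {Lam p t₁ t₂ s₁ s₂ : ℝ} {Ω K : Set (E n)}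
    {u : E n → ℝ → ℝ} (hu : ViscSubsolution Lam p Ω t₁ t₂ u)
    (hcont : ContinuousOn (fun q : E n × ℝ => u q.1 q.2) (closure Ω ×ˢ Icc t₁ t₂))
    (hK : IsCompact K) (hKΩ : K ⊆ Ω) (h₁ : t₁ ≤ s₁) (h₂ : s₂ ≤ t₂)
    (N : E n →L[ℝ] E n) (ℓ : E n →L[ℝ] ℝ) (z : E n) (a ρ k : ℝ) (hk : 0 ≤ k)
    (hρ : Lam * (k ^ n * LinearMap.det (N : E n →ₗ[ℝ] E n) ^ 2) ^ p < ρ)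
    (hbot : ∀ x ∈ K, u x s₁ ≤ movingParaboloid N ℓ z a ρ k x s₁)
    (hlat : ∀ x ∈ K, x ∉ interior K → ∀ s ∈ Icc s₁ s₂,
      u x s ≤ movingParaboloid N ℓ z a ρ k x s) :
    ∀ x ∈ K, ∀ s ∈ Icc s₁ s₂, u x s ≤ movingParaboloid N ℓ z a ρ k x s := by
  intro x hx s hs
  set φ := movingParaboloid N ℓ z a ρ k with hφ
  have hsub : K ×ˢ Icc s₁ s₂ ⊆ closure Ω ×ˢ Icc t₁ t₂ :=
    Set.prod_mono (hKΩ.trans subset_closure) (Icc_subset_Icc h₁ h₂)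
  obtain ⟨⟨x₀, t₀⟩, ⟨hx₀, ht₀⟩, hmax⟩ := (hK.prod (isCompact_Icc (a := s₁) (b := s₂))).exists_isMaxOn
    ⟨(x, s), hx, hs⟩ ((hcont.mono hsub).sub
      (movingParaboloid.continuous_uncurry N ℓ z a ρ k).continuousOn)
  simp only at hx₀ ht₀
  by_contra! hlt
  have hpos : φ x₀ t₀ < u x₀ t₀ := by
    have := hmax (show (x, s) ∈ K ×ˢ Icc s₁ s₂ from ⟨hx, hs⟩)
    simp only [mem_ofPred_eq, Pi.sub_apply] at this
    linarith
  have hint : x₀ ∈ interior K := by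
    by_contra hni
    exact absurd (hlat x₀ hx₀ hni t₀ ht₀) (not_le.2 hpos)
  have hlt₀ : s₁ < t₀ := by
    refine lt_of_le_of_ne ht₀.1 fun h => ?_
    subst h
    exact absurd (hbot x₀ hx₀) (not_le.2 hpos)
  obtain ⟨ε, hε, hball⟩ := Metric.isOpen_iff.1 isOpen_interior x₀ hint
  have := hu x₀ (hKΩ hx₀) t₀ ⟨h₁.trans_lt hlt₀, ht₀.2.trans h₂⟩ φ
    (movingParaboloid.isTestAt N ℓ z a ρ k x₀ t₀)
    ⟨min ε (t₀ - s₁), lt_min hε (sub_pos.2 hlt₀), fun y _ t _ htt₀ hdy hdt => ?_⟩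
  · rw [movingParaboloid.timeDeriv_eq, movingParaboloid.det_hessMatrix,
      max_eq_left (by positivity)] at this
    linarith
  · have hy : y ∈ K := interior_subset (hball (lt_of_lt_of_le hdy (min_le_left _ _)))
    have hd := lt_of_lt_of_le hdt (min_le_right _ _)
    rw [Real.dist_eq, abs_lt] at hd
    exact hmax (show (y, t) ∈ K ×ˢ Icc s₁ s₂ from ⟨hy, by linarith, htt₀.trans ht₀.2⟩)

/-- Comparison of a supersolution with a slower moving paraboloid. -/
lemma ViscSupersolution.movingParaboloid_le {lam p t₁ t₂ s₁ s₂ : ℝ} {Ω K : Set (E n)}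
    {u : E n → ℝ → ℝ} (hu : ViscSupersolution lam p Ω t₁ t₂ u)
    (hcont : ContinuousOn (fun q : E n × ℝ => u q.1 q.2) (closure Ω ×ˢ Icc t₁ t₂))
    (hK : IsCompact K) (hKΩ : K ⊆ Ω) (h₁ : t₁ ≤ s₁) (h₂ : s₂ ≤ t₂)
    (N : E n →L[ℝ] E n) (ℓ : E n →L[ℝ] ℝ) (z : E n) (a ρ k : ℝ) (hk : 0 ≤ k)
    (hρ : ρ < lam * (k ^ n * LinearMap.det (N : E n →ₗ[ℝ] E n) ^ 2) ^ p)
    (hbot : ∀ x ∈ K, movingParaboloid N ℓ z a ρ k x s₁ ≤ u x s₁)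
    (hlat : ∀ x ∈ K, x ∉ interior K → ∀ s ∈ Icc s₁ s₂,
      movingParaboloid N ℓ z a ρ k x s ≤ u x s) :
    ∀ x ∈ K, ∀ s ∈ Icc s₁ s₂, movingParaboloid N ℓ z a ρ k x s ≤ u x s := by
  intro x hx s hs
  set φ := movingParaboloid N ℓ z a ρ k with hφ
  have hsub : K ×ˢ Icc s₁ s₂ ⊆ closure Ω ×ˢ Icc t₁ t₂ :=
    Set.prod_mono (hKΩ.trans subset_closure) (Icc_subset_Icc h₁ h₂)
  obtain ⟨⟨x₀, t₀⟩, ⟨hx₀, ht₀⟩, hmin⟩ := (hK.prod (isCompact_Icc (a := s₁) (b := s₂))).exists_isMinOn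
    ⟨(x, s), hx, hs⟩ ((hcont.mono hsub).sub
      (movingParaboloid.continuous_uncurry N ℓ z a ρ k).continuousOn)
  simp only at hx₀ ht₀
  by_contra! hlt
  have hpos : u x₀ t₀ < φ x₀ t₀ := by
    have := hmin (show (x, s) ∈ K ×ˢ Icc s₁ s₂ from ⟨hx, hs⟩)
    simp only [mem_ofPred_eq, Pi.sub_apply] at this
    linarith
  have hint : x₀ ∈ interior K := by
    by_contra hni
    exact absurd (hlat x₀ hx₀ hni t₀ ht₀) (not_le.2 hpos)
  have hlt₀ : s₁ < t₀ := by
    refine lt_of_le_of_ne ht₀.1 fun h => ?_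
    subst h
    exact absurd (hbot x₀ hx₀) (not_le.2 hpos)
  obtain ⟨ε, hε, hball⟩ := Metric.isOpen_iff.1 isOpen_interior x₀ hint
  have := hu x₀ (hKΩ hx₀) t₀ ⟨h₁.trans_lt hlt₀, ht₀.2.trans h₂⟩ φ
    (movingParaboloid.isTestAt N ℓ z a ρ k x₀ t₀)
    ⟨min ε (t₀ - s₁), lt_min hε (sub_pos.2 hlt₀), fun y _ t _ htt₀ hdy hdt => ?_⟩
    (movingParaboloid.posSemidef_hessMatrix N ℓ z a ρ k hk x₀ t₀)
  · rw [movingParaboloid.timeDeriv_eq, movingParaboloid.det_hessMatrix] at this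
    linarith
  · have hy : y ∈ K := interior_subset (hball (lt_of_lt_of_le hdy (min_le_left _ _)))
    have hd := lt_of_lt_of_le hdt (min_le_right _ _)
    rw [Real.dist_eq, abs_lt] at hd
    exact hmin (show (y, t) ∈ K ×ˢ Icc s₁ s₂ from ⟨hy, by linarith, htt₀.trans ht₀.2⟩)

/-- Hahn–Banach: a line lying below the graph of a convex function along a line through the
origin extends to a hyperplane lying below the whole graph. -/
lemma ConvexOn.exists_affine_le_of_line {Ω : Set (E n)} {g : E n → ℝ} (hΩ : IsOpen Ω)
    (h0 : (0 : E n) ∈ Ω) (hg : ConvexOn ℝ Ω g) (hcont : ContinuousOn g Ω) (e : E n)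
    {H β : ℝ} (hline : ∀ r : ℝ, r • e ∈ Ω → -H + β * r ≤ g (r • e)) :
    ∃ q : E n, ⟪q, e⟫ = β ∧ ∀ x ∈ Ω, -H + ⟪q, x⟫ ≤ g x := by
  set L : Set (E n × ℝ) := range fun r : ℝ => (r • e, -H + β * r)
  have hopen : IsOpen {w : E n × ℝ | w.1 ∈ Ω ∧ g w.1 < w.2} := by
    have hc : ContinuousOn (fun w : E n × ℝ => w.2 - g w.1) (Prod.fst ⁻¹' Ω) :=
      continuousOn_snd.sub (hcont.comp continuousOn_fst fun w hw => hw)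
    have := hc.isOpen_inter_preimage (hΩ.preimage continuous_fst) (isOpen_Ioi (a := 0))
    convert this using 1
    ext w
    simp
  have hL : Convex ℝ L := by
    rintro _ ⟨r, rfl⟩ _ ⟨s, rfl⟩ a b _ _ hab
    refine ⟨a * r + b * s, ?_⟩
    ext1
    · simp [add_smul, mul_smul]
    · simp only [Prod.smul_mk, Prod.mk_add_mk, smul_eq_mul]
      linear_combination H * hab
  obtain ⟨f, c, hf₁, hf₂⟩ := geometric_hahn_banach_open hg.convex_strict_epigraph hopen hL (by
    rw [Set.disjoint_left]
    rintro _ ⟨hw, hlt⟩ ⟨r, rfl⟩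
    exact absurd (hline r hw) (not_le.2 hlt))
  have hsplit : ∀ (x : E n) (y : ℝ), f (x, y) = f (x, 0) + y * f (0, 1) := by
    intro x y
    rw [← smul_eq_mul, ← map_smul, ← map_add]
    simp
  have hlineval : ∀ r : ℝ, c ≤ r * (f (e, 0) + β * f (0, 1)) - H * f (0, 1) := by
    intro r
    have := hf₂ _ ⟨r, rfl⟩
    rw [hsplit] at this
    have h2 : f (r • e, 0) = r * f (e, 0) := by
      rw [← smul_eq_mul, ← map_smul]; simp
    rw [h2] at this
    linarith
  have hzero : f (e, 0) + β * f (0, 1) = 0 := by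
    by_contra hne
    have := hlineval ((c + H * f (0, 1) - 1) / (f (e, 0) + β * f (0, 1)))
    rw [div_mul_cancel₀ _ hne] at this
    linarith
  have hc0 : c ≤ - H * f (0, 1) := by simpa using hlineval 0
  have hg0 : ∀ x ∈ Ω, ∀ y, g x < y → f (x, 0) + y * f (0, 1) < c := by
    intro x hx y hy
    rw [← hsplit]
    exact hf₁ (x, y) ⟨hx, hy⟩
  have hneg : f (0, 1) < 0 := by
    have h1 := hg0 0 h0 (max (g 0) (-H) + 1) (by linarith [le_max_left (g 0) (-H)])
    have h2 : f ((0 : E n), (0 : ℝ)) = 0 := map_zero f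
    rw [h2] at h1
    by_contra! hge
    nlinarith [le_max_right (g 0) (-H)]
  obtain ⟨k, hk⟩ : ∃ k, k = (-f (0, 1))⁻¹ := ⟨_, rfl⟩
  have hkpos : 0 < k := by rw [hk]; exact inv_pos.2 (by linarith)
  have hkf : k * f (0, 1) = -1 := by rw [hk, inv_neg, neg_mul, inv_mul_cancel₀ hneg.ne]
  set F : StrongDual ℝ (E n) := k • (f.comp (ContinuousLinearMap.inl ℝ (E n) ℝ))
  have hF : ∀ x, ⟪(InnerProductSpace.toDual ℝ (E n)).symm F, x⟫ = k * f (x, 0) := by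
    intro x
    rw [InnerProductSpace.toDual_symm_apply]
    rfl
  refine ⟨(InnerProductSpace.toDual ℝ (E n)).symm F, ?_, fun x hx => ?_⟩
  · rw [hF]
    linear_combination k * hzero - β * hkf
  · rw [hF]
    refine le_of_forall_gt fun y hy => ?_
    have := mul_lt_mul_of_pos_left ((hg0 x hx y hy).trans_le hc0) hkpos
    have h1 : k * (f (x, 0) + y * f (0, 1)) = k * f (x, 0) - y := by
      linear_combination y * hkf
    have h2 : k * (-H * f (0, 1)) = H := by linear_combination -H * hkf
    linarith

/-- Squeezing a linear map `A` by the factor `κ` in the direction `A e`. -/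
lemma exists_squeeze (A : E n →L[ℝ] E n) {e : E n} (he : A e ≠ 0) (κ : ℝ) :
    ∃ (N : E n →L[ℝ] E n) (m : E n →L[ℝ] ℝ),
      LinearMap.det (N : E n →ₗ[ℝ] E n) = κ * LinearMap.det (A : E n →ₗ[ℝ] E n) ∧ m e = 1 ∧
      ∀ y, ‖N y‖ ^ 2 = ‖A (y - m y • e)‖ ^ 2 + (κ * m y * ‖A e‖) ^ 2 := by
  have hn : ‖A e‖ ^ 2 ≠ 0 := pow_ne_zero 2 (norm_ne_zero_iff.2 he)
  set f : E n →L[ℝ] ℝ := (‖A e‖ ^ 2)⁻¹ • innerSL ℝ (A e) with hf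
  have hfe : f (A e) = 1 := by simp [hf, hn]
  set P : E n →ₗ[ℝ] E n := LinearMap.transvection (f : E n →ₗ[ℝ] ℝ) (-(1 - κ) • A e) with hP
  refine ⟨(LinearMap.toContinuousLinearMap P).comp A, f.comp A, ?_, hfe, fun y => ?_⟩
  · have h1 : (((LinearMap.toContinuousLinearMap P).comp A : E n →L[ℝ] E n) : E n →ₗ[ℝ] E n) =
        P ∘ₗ (A : E n →ₗ[ℝ] E n) := rfl
    rw [h1, LinearMap.det_comp, hP, LinearMap.transvection.det]
    simp [hfe]
  · have h1 : ((LinearMap.toContinuousLinearMap P).comp A) y =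
        A (y - f (A y) • e) + (κ * f (A y)) • A e := by
      simp only [ContinuousLinearMap.comp_apply, LinearMap.coe_toContinuousLinearMap', hP,
        LinearMap.transvection.apply, ContinuousLinearMap.coe_coe, map_sub, map_smul]
      module
    have h2 : ⟪A (y - f (A y) • e), (κ * f (A y)) • A e⟫ = 0 := by
      have h3 : f (A y) * ‖A e‖ ^ 2 = ⟪A e, A y⟫ := by
        simp [hf]; field_simp
      rw [map_sub, map_smul, inner_smul_right, inner_sub_left, inner_smul_left,
        real_inner_self_eq_norm_sq, real_inner_comm]
      simp [h3]
    rw [ContinuousLinearMap.comp_apply (g := f), h1, norm_add_sq_real, h2, norm_smul]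
    simp only [Real.norm_eq_abs, mul_pow, sq_abs]
    ring

lemma ParabolicRegular.continuousOn_time {Ω : Set (E n)} {t₁ t₂ t : ℝ} {u : E n → ℝ → ℝ}
    (hu : ParabolicRegular Ω t₁ t₂ u) (ht : t ∈ Icc t₁ t₂) : ContinuousOn (fun x => u x t) Ω :=
  hu.cont.comp (continuousOn_id.prodMk continuousOn_const)
    fun _ hx => ⟨subset_closure hx, ht⟩

/-- A supersolution vanishing at the present lies below `0` for a controlled time only, measured
by the size of a compactly contained section. -/
lemma ViscSupersolution.time_le {lam p T t₀ h d : ℝ} {Ω : Set (E n)} {u : E n → ℝ → ℝ} {q : E n}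
    (hΩ : IsOpen Ω) (hreg : ParabolicRegular Ω (-T) 0 u) (hu : ViscSupersolution lam p Ω (-T) 0 u)
    (hu0 : u 0 0 = 0) (ht₀ : t₀ ∈ Ioc 0 T) (hh : 0 < h) (hd : 1 ≤ d) (A : E n →L[ℝ] E n)
    (h0 : (0 : E n) ∈ {x ∈ Ω | u x (-t₀) < h + ⟪q, x⟫})
    (hcpt : IsCompact (closure {x ∈ Ω | u x (-t₀) < h + ⟪q, x⟫}))
    (hsub : closure {x ∈ Ω | u x (-t₀) < h + ⟪q, x⟫} ⊆ Ω)
    (hA : ∀ x ∈ {x ∈ Ω | u x (-t₀) < h + ⟪q, x⟫}, ‖A x‖ ≤ d)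
    (hlow : ∀ x ∈ {x ∈ Ω | u x (-t₀) < h + ⟪q, x⟫}, -(1 + 2 * d) * h ≤ u x (-t₀) - ⟪q, x⟫) :
    t₀ * (lam * ((h / d ^ 2) ^ n * LinearMap.det (A : E n →ₗ[ℝ] E n) ^ 2) ^ p)
      ≤ (2 * d + 5 / 2) * h := by
  set S := {x ∈ Ω | u x (-t₀) < h + ⟪q, x⟫} with hS
  have ht₀pos : 0 < t₀ := ht₀.1
  have htime : -t₀ ∈ Icc (-T) 0 := ⟨neg_le_neg ht₀.2, by linarith⟩
  have hopen : IsOpen S := by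
    have hc : ContinuousOn (fun x => u x (-t₀) - (h + ⟪q, x⟫)) Ω :=
      (hreg.continuousOn_time htime).sub (by fun_prop)
    have := hc.isOpen_inter_preimage hΩ (isOpen_Iio (a := 0))
    convert this using 1
    ext x
    simp [hS]
  have hA' : ∀ x ∈ closure S, ‖A x‖ ≤ d := fun x hx =>
    closure_minimal (t := {x | ‖A x‖ ≤ d}) hA
      (isClosed_le (by fun_prop) continuous_const) hx
  have hbdry : ∀ x ∈ closure S, x ∉ S → h + ⟪q, x⟫ ≤ u x (-t₀) := by
    intro x hx hxS
    by_contra! hlt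
    exact hxS ⟨hsub hx, hlt⟩
  by_contra! hlt
  have hd2 : 0 < d ^ 2 := by positivity
  set ρ := (2 * d + 5 / 2) * h / t₀ with hρ
  have hρt : ρ * t₀ = (2 * d + 5 / 2) * h := by rw [hρ]; field_simp
  have hρ0 : 0 < ρ := by rw [hρ]; positivity
  have hquad : ∀ x ∈ closure S, h / d ^ 2 / 2 * ‖A (x - 0)‖ ^ 2 ≤ h / 2 := by
    intro x hx
    have h1 : ‖A (x - 0)‖ ^ 2 ≤ d ^ 2 := by
      rw [sub_zero]; gcongr; exact hA' x hx
    calc h / d ^ 2 / 2 * ‖A (x - 0)‖ ^ 2 ≤ h / d ^ 2 / 2 * d ^ 2 := by gcongr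
      _ = h / 2 := by field_simp
  have key := hu.movingParaboloid_le hreg.cont hcpt hsub htime.1 le_rfl A (innerSL ℝ q) 0
    (-(2 * d + 2) * h + ρ * t₀) ρ (h / d ^ 2) (by positivity) (by
      rw [hρ, div_lt_iff₀ ht₀pos]; linarith) ?_ ?_ 0 (subset_closure h0) 0 ⟨htime.2, le_rfl⟩
  · simp only [movingParaboloid, hu0, sub_zero, map_zero, norm_zero] at key
    nlinarith
  · intro x hx
    have h1 : -(1 + 2 * d) * h ≤ u x (-t₀) - ⟪q, x⟫ := by
      by_cases hxS : x ∈ S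
      · exact hlow x hxS
      · nlinarith [hbdry x hx hxS]
    have h2 := hquad x hx
    simp only [movingParaboloid, innerSL_apply_apply]
    linarith
  · intro x hx hxint s hs
    have h1 := hbdry x hx fun hxS =>
      hxint (interior_maximal subset_closure hopen hxS)
    have h2 := hquad x hx
    have h3 := hreg.mono x (subset_closure (hsub hx)) (-t₀) htime s
      ⟨htime.1.trans hs.1, hs.2⟩ hs.1
    have h4 : ρ * s ≤ 0 := mul_nonpos_of_nonneg_of_nonpos hρ0.le hs.2
    simp only [movingParaboloid, innerSL_apply_apply]
    linarith

lemma ConvexOn.le_on_line {Ω : Set (E n)} {g : E n → ℝ} (hg : ConvexOn ℝ Ω g) (e : E n)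
    {r s a : ℝ} (hr : r • e ∈ Ω) (hs : s • e ∈ Ω) (ha₀ : 0 ≤ a) (ha₁ : a ≤ 1) :
    (a * r + (1 - a) * s) • e ∈ Ω ∧
      g ((a * r + (1 - a) * s) • e) ≤ a * g (r • e) + (1 - a) * g (s • e) := by
  have h : (a * r + (1 - a) * s) • e = a • (r • e) + (1 - a) • (s • e) := by module
  rw [h]
  exact ⟨hg.1 hr hs ha₀ (by linarith) (by ring), hg.2 hr hs ha₀ (by linarith) (by ring)⟩

/-- If a convex function is nonpositive at `0`, controlled at `R e`, and dips below a line at some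
point of the ray, then it dips below a line of the larger slope at the midpoint of `[0, R e]`. -/
lemma ConvexOn.midpoint_le_of_dip {Ω : Set (E n)} {g : E n → ℝ} {e : E n} {r R β h γ : ℝ}
    (hg : ConvexOn ℝ Ω g) (hh : 0 < h) (hγ : 0 ≤ γ) (hRpos : 0 < R) (hR : γ * R = 99 * h)
    (h0e : (0 : ℝ) • e ∈ Ω) (hz : g 0 ≤ 0) (hReΩ : R • e ∈ Ω)
    (hRg : g (R • e) ≤ β * R + 99 * h) (hr : 0 ≤ r) (hrΩ : r • e ∈ Ω)
    (hlt : g (r • e) < -(100 ^ 2 * h) + (β - γ / 6) * r) :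
    (R / 2) • e ∈ Ω ∧ g ((R / 2) • e) ≤ β * (R / 2) - 33 / 4 * h := by
  rcases le_total r (R / 2) with hcase | hcase
  · have hden : 0 < R - r := by linarith
    obtain ⟨a, ha⟩ : ∃ a, a = R / 2 / (R - r) := ⟨_, rfl⟩
    have ha' : a * (R - r) = R / 2 := by rw [ha]; field_simp
    have ha₁ : a ≤ 1 := by rw [ha, div_le_one hden]; linarith
    have ha₀ : 1 / 2 ≤ a := by rw [ha, le_div_iff₀ hden]; linarith
    obtain ⟨h1, h2⟩ := hg.le_on_line e hrΩ hReΩ (by linarith) ha₁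
    have h3 : a * r + (1 - a) * R = R / 2 := by linarith
    rw [h3] at h1 h2
    refine ⟨h1, h2.trans ?_⟩
    have h4 : a * g (r • e) ≤ a * (-(100 ^ 2 * h) + β * r) := by
      refine mul_le_mul_of_nonneg_left (hlt.le.trans ?_) (by linarith)
      nlinarith [mul_nonneg hγ hr]
    have h5 : (1 - a) * g (R • e) ≤ (1 - a) * (β * R + 99 * h) :=
      mul_le_mul_of_nonneg_left hRg (by linarith)
    have h6 : a * (β * r) + (1 - a) * (β * R) = β * (R / 2) := by
      linear_combination β * h3
    nlinarith [mul_le_mul_of_nonneg_right ha₀ hh.le]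
  · have hrpos : 0 < r := by linarith
    obtain ⟨a, ha⟩ : ∃ a, a = R / 2 / r := ⟨_, rfl⟩
    have ha' : a * r = R / 2 := by rw [ha]; field_simp
    have ha₁ : a ≤ 1 := by rw [ha, div_le_one hrpos]; linarith
    have ha₀ : 0 ≤ a := by rw [ha]; positivity
    obtain ⟨h1, h2⟩ := hg.le_on_line e hrΩ h0e ha₀ ha₁
    have h3 : a * r + (1 - a) * 0 = R / 2 := by linarith
    rw [h3] at h1 h2
    refine ⟨h1, h2.trans ?_⟩
    simp only [zero_smul]
    have h4 : a * g (r • e) ≤ a * (-(100 ^ 2 * h) + (β - γ / 6) * r) :=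
      mul_le_mul_of_nonneg_left hlt.le ha₀
    have h5 : (1 - a) * g 0 ≤ 0 :=
      mul_nonpos_of_nonneg_of_nonpos (by linarith) hz
    have h6 : a * (-(100 ^ 2 * h) + (β - γ / 6) * r) =
        -(a * (100 ^ 2 * h)) + β * (R / 2) - 99 * h / 12 := by
      linear_combination (β - γ / 6) * ha' - 1 / 12 * hR
    have h7 : 0 ≤ a * (100 ^ 2 * h) := by positivity
    linarith

/-- A convex function controlled on the unit ball of `A` and at the point `R e` is controlled on a
ball, centred at the midpoint and stretched in the direction `e`. -/
lemma ConvexOn.le_on_stretched_ball {Ω : Set (E n)} {g : E n → ℝ} {q e : E n} {R β h κ : ℝ}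
    (hg : ConvexOn ℝ Ω g) (hh : 0 < h) (hRpos : 0 < R) (hκ : 0 < κ) {A N : E n →L[ℝ] E n}
    {m : E n →L[ℝ] ℝ} (hme : m e = 1)
    (hN : ∀ y, ‖N y‖ ^ 2 = ‖A (y - m y • e)‖ ^ 2 + (κ * m y * ‖A e‖) ^ 2)
    (hκR : 1 ≤ κ * ‖A e‖ * R) (hball : ∀ x, ‖A x‖ < 1 → x ∈ Ω ∧ g x ≤ h + ⟪q, x⟫)
    (hReΩ : R • e ∈ Ω) (hRg : g (R • e) ≤ β * R + 99 * h) {y : E n} (hy : ‖N y‖ ^ 2 ≤ 1 / 25) :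
    (R / 2) • e + y ∈ Ω ∧ g ((R / 2) • e + y) ≤
      (innerSL ℝ q + (β - ⟪q, e⟫) • m) ((R / 2) • e + y) + 99 * h := by
  set ℓ : E n →L[ℝ] ℝ := innerSL ℝ q + (β - ⟪q, e⟫) • m with hℓ
  have hℓre : ∀ r : ℝ, ℓ (r • e) = β * r := fun r => by
    simp [hℓ, hme]
    ring
  have hny := hN y
  have h1 : |κ * m y * ‖A e‖| ≤ 1 / 5 :=
    abs_le_of_sq_le_sq (by nlinarith [sq_nonneg ‖A (y - m y • e)‖]) (by norm_num)
  have h2 : ‖A (y - m y • e)‖ ≤ 1 / 5 :=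
    (abs_le_of_sq_le_sq' (by nlinarith [sq_nonneg (κ * m y * ‖A e‖)]) (by norm_num)).2
  have h4 : |m y| ≤ R / 5 := by
    have h5 : κ * ‖A e‖ * |m y| ≤ 1 / 5 := by
      rw [show κ * m y * ‖A e‖ = κ * ‖A e‖ * m y by ring, abs_mul,
        abs_of_nonneg (by positivity)] at h1
      exact h1
    have h6 : R * (κ * ‖A e‖ * |m y|) ≤ R * (1 / 5) :=
      mul_le_mul_of_nonneg_left h5 hRpos.le
    nlinarith [abs_nonneg (m y)]
  obtain ⟨μ, hμ⟩ : ∃ μ, μ = 1 / 2 + m y / R := ⟨_, rfl⟩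
  have hμR : μ * R = R / 2 + m y := by rw [hμ]; field_simp
  obtain ⟨h5, h6⟩ := abs_le.1 h4
  have hμ₀ : 3 / 10 ≤ μ := le_of_mul_le_mul_right (by linarith) hRpos
  have hμ₁ : μ ≤ 7 / 10 := le_of_mul_le_mul_right (by linarith) hRpos
  have hμ' : 0 < 1 - μ := by linarith
  set z := (1 - μ)⁻¹ • (y - m y • e) with hz
  have hAz : ‖A z‖ < 1 := by
    rw [hz, map_smul, norm_smul, Real.norm_eq_abs, abs_of_pos (inv_pos.2 hμ'),
      inv_mul_lt_iff₀ hμ']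
    linarith
  obtain ⟨hzΩ, hzg⟩ := hball z hAz
  have hℓz : ℓ z = ⟪q, z⟫ := by
    have : m z = 0 := by simp [hz, hme]
    simp [hℓ, this]
  have hx : (R / 2) • e + y = μ • (R • e) + (1 - μ) • z := by
    rw [hz, smul_inv_smul₀ hμ'.ne', smul_smul, hμR]
    module
  rw [hx]
  refine ⟨hg.1 hReΩ hzΩ (by linarith) hμ'.le (by ring), ?_⟩
  refine (hg.2 hReΩ hzΩ (by linarith) hμ'.le (by ring)).trans ?_
  rw [map_add, map_smul, map_smul ℓ (1 - μ), hℓre, hℓz]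
  simp only [smul_eq_mul]
  have h7 : μ * g (R • e) ≤ μ * (β * R + 99 * h) :=
    mul_le_mul_of_nonneg_left hRg (by linarith)
  have h8 : (1 - μ) * g z ≤ (1 - μ) * (99 * h + ⟪q, z⟫) :=
    mul_le_mul_of_nonneg_left (by linarith) hμ'.le
  linarith

/-- One side of an angle, in the direction `e`, survives backwards in time. -/
lemma ViscSubsolution.side_le {Lam p T t₀ t h δ α β r₀ : ℝ} {Ω : Set (E n)} {u : E n → ℝ → ℝ}
    {q e : E n} (hΩb : Bornology.IsBounded Ω) (hΩ : Convex ℝ Ω)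
    (hreg : ParabolicRegular Ω (-T) 0 u) (hu : ViscSubsolution Lam p Ω (-T) 0 u) (hLam : 0 < Lam)
    (h0 : (0 : E n) ∈ Ω) (hu0 : u 0 0 = 0) (ht₀ : 0 < t₀) (htt : t₀ ≤ t) (htT : t ≤ T)
    (hh : 0 < h) (hδ : 0 < δ) (hα : 0 < α) (A : E n →L[ℝ] E n)
    (hdet : LinearMap.det (A : E n →ₗ[ℝ] E n) ≠ 0)
    (hball : ∀ x, ‖A x‖ < 1 → x ∈ Ω ∧ u x (-t₀) ≤ h + ⟪q, x⟫)
    (hAe : A e ≠ 0) (hαe : α ≤ 4 * h * ‖A e‖)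
    (hline : ∀ r : ℝ, r • e ∈ Ω → -h + β * r ≤ u (r • e) (-t₀))
    (hr₀ : 0 < r₀) (hr₀Ω : r₀ • e ∈ Ω) (hr₀u : u (r₀ • e) (-t₀) < -(100 * h) + (β + δ * α) * r₀)
    (htime : 2 * (Lam * ((10 ^ 7 * h) ^ n *
      (δ / 24 * LinearMap.det (A : E n →ₗ[ℝ] E n)) ^ 2) ^ p) * (t - t₀) ≤ 3 * h) :
    ∀ r : ℝ, 0 ≤ r → r • e ∈ Ω →
      -(100 ^ 2 * h) + (β - δ * α / 6) * r ≤ u (r • e) (-t) := by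
  intro r hr hrΩ
  by_contra! hlt
  have hδα : 0 < δ * α := mul_pos hδ hα
  have hm₀ : -t₀ ∈ Icc (-T) 0 := ⟨by linarith, by linarith⟩
  have hm : -t ∈ Icc (-T) 0 := ⟨by linarith, by linarith⟩
  have hmono : ∀ x ∈ Ω, u x (-t) ≤ u x (-t₀) := fun x hx =>
    hreg.mono x (subset_closure hx) _ hm _ hm₀ (by linarith)
  have hz₀ : u 0 (-t₀) ≤ 0 :=
    hu0 ▸ hreg.mono 0 (subset_closure h0) _ hm₀ 0 ⟨by linarith, le_rfl⟩ (by linarith)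
  have hz : u 0 (-t) ≤ 0 := (hmono 0 h0).trans hz₀
  have hc₀ : ConvexOn ℝ Ω fun x => u x (-t₀) := (hreg.conv _ hm₀).subset subset_closure hΩ
  have hc : ConvexOn ℝ Ω fun x => u x (-t) := (hreg.conv _ hm).subset subset_closure hΩ
  have h0e : (0 : ℝ) • e ∈ Ω := by simpa using h0
  obtain ⟨R, hRdef⟩ : ∃ R, R = 99 * h / (δ * α) := ⟨_, rfl⟩
  have hR : δ * α * R = 99 * h := by rw [hRdef]; field_simp
  have hRpos : 0 < R := by rw [hRdef]; positivity
  have hRr : R ≤ r₀ := by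
    have := hline r₀ hr₀Ω
    refine le_of_mul_le_mul_left ?_ hδα
    linarith
  have hRe : R • e ∈ Ω ∧ u (R • e) (-t₀) ≤ β * R + 99 * h := by
    have ha : 0 ≤ R / r₀ := by positivity
    obtain ⟨h1, h2⟩ := hc₀.le_on_line e hr₀Ω h0e ha ((div_le_one hr₀).2 hRr)
    have h3 : R / r₀ * r₀ + (1 - R / r₀) * 0 = R := by field_simp; ring
    rw [h3] at h1 h2
    refine ⟨h1, h2.trans ?_⟩
    simp only [zero_smul]
    have h4 : R / r₀ * u (r₀ • e) (-t₀) ≤ R / r₀ * (-(100 * h) + (β + δ * α) * r₀) :=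
      mul_le_mul_of_nonneg_left hr₀u.le ha
    have h5 : R / r₀ * (-(100 * h) + (β + δ * α) * r₀) = -(R / r₀ * (100 * h)) +
        β * R + δ * α * R := by field_simp; ring
    have h6 : 0 ≤ R / r₀ * (100 * h) := by positivity
    have h7 : (1 - R / r₀) * u 0 (-t₀) ≤ 0 :=
      mul_nonpos_of_nonneg_of_nonpos (by linarith [(div_le_one hr₀).2 hRr]) hz₀
    linarith
  obtain ⟨hReΩ, hReu⟩ := hRe
  obtain ⟨hmidΩ, hmidu⟩ := hc.midpoint_le_of_dip hh hδα.le hRpos hR h0e hz hReΩ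
    ((hmono _ hReΩ).trans hReu) hr hrΩ hlt
  obtain ⟨N, m, hNdet, hme, hN⟩ := exists_squeeze A hAe (δ / 24)
  set ℓ : E n →L[ℝ] ℝ := innerSL ℝ q + (β - ⟪q, e⟫) • m with hℓ
  have hℓe : ℓ e = β := by simp [hℓ, hme]
  have hℓre : ∀ r : ℝ, ℓ (r • e) = β * r := by
    intro r; rw [map_smul, hℓe, smul_eq_mul, mul_comm]
  have hκR : 1 ≤ δ / 24 * ‖A e‖ * R := by
    have : δ * R * α ≤ δ * R * (4 * h * ‖A e‖) :=
      mul_le_mul_of_nonneg_left hαe (by positivity)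
    nlinarith
  have hell : ∀ y, ‖N y‖ ^ 2 ≤ 1 / 25 → (R / 2) • e + y ∈ Ω ∧
      u ((R / 2) • e + y) (-t₀) ≤ ℓ ((R / 2) • e + y) + 99 * h := fun y hy =>
    hc₀.le_on_stretched_ball hh hRpos (by positivity) hme hN hκR hball hReΩ hReu hy
  set K : Set (E n) := {x | ‖N (x - (R / 2) • e)‖ ^ 2 ≤ 1 / 25} with hKdef
  have hKell : ∀ x ∈ K, x ∈ Ω ∧ u x (-t₀) ≤ ℓ x + 99 * h := by
    intro x hx
    simpa using hell (x - (R / 2) • e) hx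
  have hKΩ : K ⊆ Ω := fun x hx => (hKell x hx).1
  have hKc : IsCompact K := Metric.isCompact_of_isClosed_isBounded
    (isClosed_le (by fun_prop) continuous_const) (hΩb.subset hKΩ)
  have hint : {x | ‖N (x - (R / 2) • e)‖ ^ 2 < 1 / 25} ⊆ interior K :=
    interior_maximal
      (fun x (hx : ‖N (x - (R / 2) • e)‖ ^ 2 < 1 / 25) =>
        show ‖N (x - (R / 2) • e)‖ ^ 2 ≤ 1 / 25 from hx.le)
      (isOpen_lt (by fun_prop) continuous_const)
  set D := (10 ^ 7 * h) ^ n * (δ / 24 * LinearMap.det (A : E n →ₗ[ℝ] E n)) ^ 2 with hD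
  have hDpos : 0 < Lam * D ^ p := by positivity
  have hbarrier : ∀ x s, movingParaboloid N ℓ ((R / 2) • e) (-(5 * h) + 2 * (Lam * D ^ p) * t)
      (2 * (Lam * D ^ p)) (10 ^ 7 * h) x s = -(5 * h) + 2 * (Lam * D ^ p) * (s + t) + ℓ x +
        5 * 10 ^ 6 * h * ‖N (x - (R / 2) • e)‖ ^ 2 := by
    intro x s
    rw [movingParaboloid]
    ring
  have key := hu.le_movingParaboloid hreg.cont hKc hKΩ hm.1 hm₀.2 N ℓ ((R / 2) • e)
    (-(5 * h) + 2 * (Lam * D ^ p) * t) (2 * (Lam * D ^ p)) (10 ^ 7 * h) (by positivity)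
    (by rw [hNdet]; change Lam * D ^ p < _; linarith) ?_ ?_ ((R / 2) • e) (by simp [hKdef]) (-t₀) ⟨by linarith, le_rfl⟩
  · rw [hbarrier, hℓre] at key
    have h1 := hline _ hmidΩ
    simp only [sub_self, map_zero, norm_zero] at key
    linarith
  · intro x hx
    rw [hbarrier]
    rcases le_total (1 / 40000) (‖N (x - (R / 2) • e)‖ ^ 2) with hcase | hcase
    · obtain ⟨h1, h2⟩ := hKell x hx
      have h3 := hmono x h1
      have h4 := mul_le_mul_of_nonneg_left hcase (show 0 ≤ 5 * 10 ^ 6 * h by positivity)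
      linarith
    · obtain ⟨h1, h2⟩ := hell ((40 : ℝ) • (x - (R / 2) • e)) (by
        rw [map_smul, norm_smul, mul_pow, Real.norm_eq_abs, abs_of_pos (by norm_num)]
        linarith)
      have h3 := hmono _ h1
      have hx' : x = (39 / 40 : ℝ) • ((R / 2) • e) +
          (1 / 40 : ℝ) • ((R / 2) • e + (40 : ℝ) • (x - (R / 2) • e)) := by module
      have h4 := hc.2 hmidΩ h1 (show (0 : ℝ) ≤ 39 / 40 by norm_num)
        (show (0 : ℝ) ≤ 1 / 40 by norm_num) (by norm_num)
      have h5 : ℓ x = 39 / 40 * (β * (R / 2)) +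
          1 / 40 * ℓ ((R / 2) • e + (40 : ℝ) • (x - (R / 2) • e)) := by
        conv_lhs => rw [hx']
        rw [map_add, map_smul, map_smul ℓ (1 / 40 : ℝ), hℓre]
        rfl
      simp only [← hx', smul_eq_mul] at h4
      have h6 : 0 ≤ 5 * 10 ^ 6 * h * ‖N (x - (R / 2) • e)‖ ^ 2 := by positivity
      linarith
  · intro x hx hxint s hs
    obtain ⟨h1, h2⟩ := hKell x hx
    have h3 := hreg.mono x (subset_closure h1) s ⟨hm.1.trans hs.1, hs.2.trans hm₀.2⟩ _ hm₀ hs.2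
    have h4 : 1 / 25 ≤ ‖N (x - (R / 2) • e)‖ ^ 2 := by
      by_contra! hlt'
      exact hxint (hint hlt')
    have h5 := mul_le_mul_of_nonneg_left h4 (show 0 ≤ 5 * 10 ^ 6 * h by positivity)
    have h6 : 0 ≤ 2 * (Lam * D ^ p) * (s + t) :=
      mul_nonneg (by linarith) (by linarith [hs.1])
    rw [hbarrier]
    linarith

/-- The waiting time allowed by the determinant of the squeezed paraboloid. -/
lemma squeezed_speed_mul_le {n : ℕ} {p lam Lam d h δ t₀ s D : ℝ} (hlam : 0 < lam)
    (hLam : 0 < Lam) (hd : 1 ≤ d) (hh : 0 < h) (hδ : 0 < δ) (hD : D ≠ 0)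
    (ht : t₀ * (lam * ((h / d ^ 2) ^ n * D ^ 2) ^ p) ≤ (2 * d + 5 / 2) * h)
    (hs : s ≤ lam / (2 * Lam * ((10 ^ 7 * d ^ 2) ^ n / 576) ^ p * (2 * d + 5 / 2)) *
      δ ^ (-(2 * p)) * t₀) :
    2 * (Lam * ((10 ^ 7 * h) ^ n * (δ / 24 * D) ^ 2) ^ p) * s ≤ 3 * h := by
  have hd0 : 0 < d := by linarith
  set G := (h / d ^ 2) ^ n * D ^ 2 with hG
  set κ := ((10 : ℝ) ^ 7 * d ^ 2) ^ n / 576 with hκ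
  have hGpos : 0 < G := by positivity
  have hκpos : 0 < κ := by positivity
  have h1 : (10 ^ 7 * h) ^ n * (δ / 24 * D) ^ 2 = κ * δ ^ 2 * G := by
    have : (10 ^ 7 * h) ^ n = (10 ^ 7 * d ^ 2) ^ n * (h / d ^ 2) ^ n := by
      rw [← mul_pow]; congr 1; field_simp
    rw [this, hG, hκ]; ring
  have h2 : (κ * δ ^ 2 * G) ^ p = κ ^ p * δ ^ (2 * p) * G ^ p := by
    rw [Real.mul_rpow (by positivity) hGpos.le, Real.mul_rpow hκpos.le (by positivity),
      Real.rpow_mul hδ.le]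
    norm_cast
  have h3 : δ ^ (2 * p) * δ ^ (-(2 * p)) = 1 := by
    rw [← Real.rpow_add hδ, add_neg_cancel, Real.rpow_zero]
  have hκp : 0 < κ ^ p := Real.rpow_pos_of_pos hκpos p
  rw [h1, h2]
  calc 2 * (Lam * (κ ^ p * δ ^ (2 * p) * G ^ p)) * s
      ≤ 2 * (Lam * (κ ^ p * δ ^ (2 * p) * G ^ p)) *
        (lam / (2 * Lam * κ ^ p * (2 * d + 5 / 2)) * δ ^ (-(2 * p)) * t₀) := by gcongr
    _ = (δ ^ (2 * p) * δ ^ (-(2 * p))) * (t₀ * (lam * G ^ p) / (2 * d + 5 / 2)) := by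
        field_simp
    _ ≤ h := by
        rw [h3, one_mul, div_le_iff₀ (by linarith)]
        linarith
    _ ≤ 3 * h := by linarith

/-- Proposition 6.4, the key angle-propagation estimate. -/
theorem stmt9 (n : ℕ) (hn : 1 ≤ n) (p lam Lam d : ℝ)
    (hp : 0 < p) (hlam : 0 < lam) (hll : lam ≤ Lam) (hd : 1 ≤ d) :
    ∃ c : ℝ, 0 < c ∧
      ∀ (Ω : Set (E n)) (T : ℝ) (u : E n → ℝ → ℝ) (δ t₀ h α : ℝ) (q : E n),
        IsOpen Ω → Convex ℝ Ω → Bornology.IsBounded Ω → 0 < T →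
        ViscositySolution lam Lam p Ω (-T) 0 u →
        (0 : E n) ∈ Ω → u 0 0 = 0 →
        0 < δ → δ ≤ 1 → t₀ ∈ Ioc 0 T → 0 < h → 0 < α →
        AngleSet Ω u (EuclideanSpace.single (⟨n-1, by omega⟩ : Fin n) (1:ℝ)) (-t₀) h α →
        ¬ AngleSet Ω u (EuclideanSpace.single (⟨n-1, by omega⟩ : Fin n) (1:ℝ)) (-t₀)
            (100 * h) ((1 + δ) * α) →
        DBalanced d {x ∈ Ω | u x (-t₀) < h + ⟪q, x⟫} 0 →
        IsCompact (closure {x ∈ Ω | u x (-t₀) < h + ⟪q, x⟫}) →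
        closure {x ∈ Ω | u x (-t₀) < h + ⟪q, x⟫} ⊆ Ω →
        ∀ t : ℝ, t₀ ≤ t → t ≤ min T (t₀ + c * δ ^ (-(2 * p)) * t₀) →
          AngleSet Ω u (EuclideanSpace.single (⟨n-1, by omega⟩ : Fin n) (1:ℝ)) (-t)
            ((100:ℝ)^2 * h) (α / (1 + δ / 2)) := by
  have hLam : 0 < Lam := hlam.trans_le hll
  have hd0 : 0 < d := by linarith
  refine ⟨lam / (2 * Lam * ((10 ^ 7 * d ^ 2) ^ n / 576) ^ p * (2 * d + 5 / 2)), by positivity, ?_⟩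
  intro Ω T u δ t₀ h α q hΩo hΩ hΩb hT hvisc h0 hu0 hδ hδ₁ ht₀ hh hα hang hnang hbal hcpt hsub
    t ht htc
  obtain ⟨hreg, hsubsol, hsupersol⟩ := hvisc
  set e : E n := EuclideanSpace.single (⟨n - 1, by omega⟩ : Fin n) (1 : ℝ) with he
  have he0 : e ≠ 0 := by simp [he]
  obtain ⟨q₁, q₂, hαq, hq⟩ := hang
  have htT : t ≤ T := htc.trans (min_le_left _ _)
  have hm₀ : -t₀ ∈ Icc (-T) 0 := ⟨neg_le_neg ht₀.2, by linarith [ht₀.1]⟩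
  have hm : -t ∈ Icc (-T) 0 := ⟨neg_le_neg htT, by linarith [ht₀.1]⟩
  have hδα : 0 < δ * α := mul_pos hδ hα
  have hq₁ : ∀ x ∈ Ω, -h + ⟪q₁, x⟫ ≤ u x (-t₀) := fun x hx => by
    linarith [hq x hx, le_max_left ⟪q₁, x⟫ ⟪q₂, x⟫]
  have hq₂ : ∀ x ∈ Ω, -h + ⟪q₂, x⟫ ≤ u x (-t₀) := fun x hx => by
    linarith [hq x hx, le_max_right ⟪q₁, x⟫ ⟪q₂, x⟫]
  rw [inner_sub_left] at hαq
  set β₁ := ⟪q₁, e⟫ with hβ₁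
  set β₂ := ⟪q₂, e⟫ with hβ₂
  have hline₁ : ∀ r : ℝ, r • e ∈ Ω → -h + β₁ * r ≤ u (r • e) (-t₀) := fun r hr => by
    have := hq₁ _ hr
    rw [inner_smul_right] at this
    linarith
  have hline₂ : ∀ r : ℝ, r • e ∈ Ω → -h + β₂ * r ≤ u (r • e) (-t₀) := fun r hr => by
    have := hq₂ _ hr
    rw [inner_smul_right] at this
    linarith
  obtain ⟨A', hAbij, hin, hout⟩ := hbal
  set A : E n →L[ℝ] E n := LinearMap.toContinuousLinearMap A' with hA
  have hAA : ∀ x, A x = A' x := fun _ => rfl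
  have hdet : LinearMap.det (A : E n →ₗ[ℝ] E n) ≠ 0 :=
    (LinearEquiv.isUnit_det' (LinearEquiv.ofBijective A' hAbij)).ne_zero
  set S := {x ∈ Ω | u x (-t₀) < h + ⟪q, x⟫} with hS
  have hballS : ∀ x, ‖A x‖ < 1 → x ∈ S := by
    intro x hx
    obtain ⟨_, ⟨y, hy, rfl⟩, hyx⟩ := hin (show A x ∈ ball 0 1 by simpa using hx)
    have : y - 0 = x := hAbij.1 hyx
    rwa [← this, sub_zero]
  have hSA : ∀ x ∈ S, ‖A x‖ < d := by
    intro x hx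
    simpa using hout ⟨x - 0, ⟨x, hx, rfl⟩, by rw [sub_zero, hAA]⟩
  have hAe : A e ≠ 0 := fun h => he0 (hAbij.1 (h.trans (map_zero A').symm))
  have hball : ∀ x, ‖A x‖ < 1 → x ∈ Ω ∧ u x (-t₀) ≤ h + ⟪q, x⟫ :=
    fun x hx => ⟨(hballS x hx).1, (hballS x hx).2.le⟩
  have hlow : ∀ x ∈ S, -(1 + 2 * d) * h ≤ u x (-t₀) - ⟪q, x⟫ := by
    intro x hx
    have h1 : ‖A (-(d⁻¹) • x)‖ < 1 := by
      rw [map_smul, norm_smul, norm_neg, Real.norm_eq_abs, abs_of_pos (inv_pos.2 hd0),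
        inv_mul_lt_iff₀ hd0, mul_one]
      exact hSA x hx
    obtain ⟨h2, h3⟩ := hballS _ h1
    have h4 := hq₁ _ h2
    rw [inner_smul_right] at h3 h4
    have h5 : d⁻¹ * (⟪q, x⟫ - ⟪q₁, x⟫) < 2 * h := by linarith
    rw [inv_mul_lt_iff₀ hd0] at h5
    linarith [hq₁ x hx.1]
  have hαe : α ≤ 4 * h * ‖A e‖ := by
    by_contra! hlt
    have hr : 4 * h / α * ‖A e‖ < 1 := by
      rw [div_mul_eq_mul_div, div_lt_one hα]
      exact hlt
    have hrpos : 0 < 4 * h / α := by positivity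
    have hrα : α * (4 * h / α) = 4 * h := by field_simp
    obtain ⟨h1, h2⟩ := hballS ((4 * h / α) • e) (by
      rwa [map_smul, norm_smul, Real.norm_eq_abs, abs_of_pos hrpos])
    obtain ⟨h3, h4⟩ := hballS ((-(4 * h / α)) • e) (by
      rwa [map_smul, norm_smul, norm_neg, Real.norm_eq_abs, abs_of_pos hrpos])
    have h5 := hline₁ _ h1
    have h6 := hline₂ _ h3
    rw [inner_smul_right] at h2 h4
    have h7 := mul_le_mul_of_nonneg_right hαq hrpos.le
    linarith
  have hz₀ : u 0 (-t₀) ≤ 0 :=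
    hu0 ▸ hreg.mono 0 (subset_closure h0) _ hm₀ 0 ⟨by linarith, le_rfl⟩ hm₀.2
  have htime := squeezed_speed_mul_le (s := t - t₀) hlam hLam hd hh hδ hdet
    (hsupersol.time_le hΩo hreg hu0 ht₀ hh hd A (hballS 0 (by simp)) hcpt hsub
      (fun x hx => (hSA x hx).le) hlow)
    (by linarith [htc.trans (min_le_right _ _)])
  have hcont₀ := hreg.continuousOn_time hm₀
  have hcont := hreg.continuousOn_time hm
  have hconv₀ : ConvexOn ℝ Ω fun x => u x (-t₀) := (hreg.conv _ hm₀).subset subset_closure hΩ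
  have hconv : ConvexOn ℝ Ω fun x => u x (-t) := (hreg.conv _ hm).subset subset_closure hΩ
  obtain ⟨r₁, hr₁, hr₁Ω, hr₁u⟩ : ∃ r : ℝ, 0 < r ∧ r • e ∈ Ω ∧
      u (r • e) (-t₀) < -(100 * h) + (β₁ + δ * α) * r := by
    by_contra! hno
    obtain ⟨q', hq'e, hq'⟩ := hconv₀.exists_affine_le_of_line hΩo h0 hcont₀ e
      (H := 100 * h) (β := β₁ + δ * α) (fun r hr => by
        rcases lt_or_ge 0 r with hpos | hneg
        · exact hno r hpos hr
        · nlinarith [hline₁ r hr])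
    refine hnang ⟨q', q₂, ?_, fun x hx => ?_⟩
    · rw [inner_sub_left, hq'e]
      linarith
    · rw [hu0]
      have := max_le (by linarith [hq' x hx] : ⟪q', x⟫ ≤ u x (-t₀) + 100 * h)
        (by linarith [hq₂ x hx] : ⟪q₂, x⟫ ≤ u x (-t₀) + 100 * h)
      linarith
  obtain ⟨r₂, hr₂, hr₂Ω, hr₂u⟩ : ∃ r : ℝ, 0 < r ∧ r • (-e) ∈ Ω ∧
      u (r • (-e)) (-t₀) < -(100 * h) + (-β₂ + δ * α) * r := by
    by_contra! hno
    obtain ⟨q', hq'e, hq'⟩ := hconv₀.exists_affine_le_of_line hΩo h0 hcont₀ e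
      (H := 100 * h) (β := β₂ - δ * α) (fun r hr => by
        rcases lt_or_ge r 0 with hneg | hpos
        · have := hno (-r) (by linarith) (by simpa using hr)
          rw [smul_neg, neg_smul, neg_neg] at this
          linarith
        · nlinarith [hline₂ r hr])
    refine hnang ⟨q₁, q', ?_, fun x hx => ?_⟩
    · rw [inner_sub_left, hq'e]
      linarith
    · rw [hu0]
      have := max_le (by linarith [hq₁ x hx] : ⟪q₁, x⟫ ≤ u x (-t₀) + 100 * h)
        (by linarith [hq' x hx] : ⟪q', x⟫ ≤ u x (-t₀) + 100 * h)
      linarith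
  have hside₁ := hsubsol.side_le hΩb hΩ hreg hLam h0 hu0 ht₀.1 ht htT hh hδ hα A hdet hball
    hAe hαe hline₁ hr₁ hr₁Ω hr₁u htime
  have hside₂ := hsubsol.side_le (e := -e) (β := -β₂) hΩb hΩ hreg hLam h0 hu0 ht₀.1 ht htT hh hδ
    hα A hdet hball (by simpa using hAe) (by simpa using hαe) (fun r hr => by
      rw [smul_neg, ← neg_smul] at hr ⊢
      linarith [hline₂ _ hr]) hr₂ hr₂Ω hr₂u htime
  have hδα' : δ * α ≤ α := mul_le_of_le_one_left hα.le hδ₁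
  have hall : ∀ r : ℝ, r • e ∈ Ω →
      -(100 ^ 2 * h) + (β₁ - δ * α / 6) * r ≤ u (r • e) (-t) ∧
      -(100 ^ 2 * h) + (β₂ + δ * α / 6) * r ≤ u (r • e) (-t) := by
    intro r hr
    rcases le_total 0 r with hpos | hneg
    · have := hside₁ r hpos hr
      exact ⟨this, by nlinarith⟩
    · have := hside₂ (-r) (by linarith) (by simpa using hr)
      rw [smul_neg, neg_smul, neg_neg] at this
      constructor <;> nlinarith
  obtain ⟨p₁, hp₁e, hp₁⟩ := hconv.exists_affine_le_of_line hΩo h0 hcont e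
    fun r hr => (hall r hr).1
  obtain ⟨p₂, hp₂e, hp₂⟩ := hconv.exists_affine_le_of_line hΩo h0 hcont e
    fun r hr => (hall r hr).2
  refine ⟨p₁, p₂, ?_, fun x hx => ?_⟩
  · rw [inner_sub_left, hp₁e, hp₂e, div_le_iff₀ (by linarith)]
    nlinarith [mul_nonneg hδα.le (sub_nonneg.2 hδ₁)]
  · rw [hu0]
    have := max_le (by linarith [hp₁ x hx] : ⟪p₁, x⟫ ≤ u x (-t) + 100 ^ 2 * h)
      (by linarith [hp₂ x hx] : ⟪p₂, x⟫ ≤ u x (-t) + 100 ^ 2 * h)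
    linarith
end
end

section
/- Let n ≥ 3 and 0 < p ≤ 1/(n−2). Let u be a viscosity supersolution of u_t ≥ λ (det D²u)^p in Ω × [0,T], continuous on Ω̄ × [0,T]. If u(x,0) ≥ |x·e_n| for all x ∈ Ω and u(x,0) > 0 for all x ∈ ∂Ω, then u(x,t) > 0 for every x ∈ Ω and every t ∈ (0,T]. -/
open Set Metric MeasureTheory
open scoped RealInnerProductSpace

noncomputable section

variable {n : ℕ}

/-- A quadratic polynomial in `(x, t)` centred at `(x₀, t₀)`, with spatial Hessian
`diag d + 2 k m mᵀ`. -/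
def quadTest (C β γ k : ℝ) (l m : E n →L[ℝ] ℝ) (d : Fin n → ℝ) (x₀ : E n) (t₀ : ℝ) :
    E n → ℝ → ℝ := fun x t =>
  C + l (x - x₀) + β * (t - t₀) + k * (m (x - x₀) + γ * (t - t₀)) ^ 2 +
    1 / 2 * ∑ i, d i * (x i - x₀ i) ^ 2

section QuadTest

variable (C β γ k : ℝ) (l m : E n →L[ℝ] ℝ) (d : Fin n → ℝ) (x₀ : E n) (t₀ : ℝ)

lemma isTestAt_quadTest : IsTestAt (quadTest C β γ k l m d x₀ t₀) x₀ t₀ := by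
  refine ⟨1, one_pos, fun t _ => ContDiff.contDiffOn ?_, fun x _ => ContDiff.contDiffOn ?_⟩
  · unfold quadTest
    fun_prop
  · unfold quadTest
    fun_prop

lemma timeDeriv_quadTest : timeDeriv (quadTest C β γ k l m d x₀ t₀) x₀ t₀ = β := by
  have h : HasDerivAt (fun t : ℝ => t - t₀) 1 t₀ := (hasDerivAt_id t₀).sub_const t₀
  have h2 := (((h.const_mul β).const_add (C + l (x₀ - x₀))).add
    (((h.const_mul γ).const_add (m (x₀ - x₀))).pow 2 |>.const_mul k)).add_const
      (1 / 2 * ∑ i, d i * (x₀ i - x₀ i) ^ 2)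
  refine (h2.congr_deriv ?_).deriv
  simp

lemma hessMatrix_quadTest :
    hessMatrix (quadTest C β γ k l m d x₀ t₀) x₀ t₀ =
      Matrix.diagonal d + (2 * k) • Matrix.vecMulVec
        (fun i => m (EuclideanSpace.single i 1)) (fun i => m (EuclideanSpace.single i 1)) := by
  have hsub : ∀ (L : E n →L[ℝ] ℝ) (y : E n), HasFDerivAt (fun z : E n => L (z - x₀)) L y :=
    fun L y => L.hasFDerivAt.comp y ((hasFDerivAt_id y).sub_const x₀)
  have hproj : ∀ (i : Fin n) (y : E n), HasFDerivAt (fun z : E n => z i - x₀ i)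
      (EuclideanSpace.proj i : E n →L[ℝ] ℝ) y := fun i y =>
    ((EuclideanSpace.proj i : E n →L[ℝ] ℝ).hasFDerivAt).sub_const (x₀ i)
  have h1 : ∀ (y : E n) (j : Fin n),
      fderiv ℝ (fun z => quadTest C β γ k l m d x₀ t₀ z t₀) y (EuclideanSpace.single j (1:ℝ)) =
        l (EuclideanSpace.single j 1) + 2 * k * m (EuclideanSpace.single j 1) * m (y - x₀) +
          d j * (y j - x₀ j) := by
    intro y j
    have hs : HasFDerivAt (fun z : E n => ∑ i, d i * (z i - x₀ i) ^ 2) _ y :=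
      HasFDerivAt.fun_sum fun i _ => ((hproj i y).pow 2).const_mul (d i)
    have h := ((((hsub l y).const_add C).add_const (β * (t₀ - t₀))).add
      ((((hsub m y).add_const (γ * (t₀ - t₀))).pow 2).const_mul k)).add (hs.const_mul (1 / 2))
    have h' : HasFDerivAt (fun z => quadTest C β γ k l m d x₀ t₀ z t₀) _ y := h
    rw [h'.fderiv]
    simp
    ring
  ext i j
  simp only [hessMatrix, Matrix.of_apply, h1]
  have h := (((hsub m x₀).const_mul (2 * k * m (EuclideanSpace.single j 1))).const_add
    (l (EuclideanSpace.single j 1))).fun_add ((hproj j x₀).const_mul (d j))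
  rw [HasFDerivAt.fderiv h]
  simp [Matrix.diagonal_apply, Matrix.vecMulVec_apply]
  by_cases hij : i = j
  · subst hij; simp; ring
  · simp [hij, Ne.symm hij]; ring

end QuadTest

lemma posSemidef_diagonal_add_vecMulVec {d v : Fin n → ℝ} {c : ℝ} (hd : 0 ≤ d) (hc : 0 ≤ c) :
    (Matrix.diagonal d + c • Matrix.vecMulVec v v).PosSemidef := by
  refine (Matrix.PosSemidef.diagonal hd).add (Matrix.PosSemidef.smul ?_ hc)
  simpa using Matrix.posSemidef_vecMulVec_self_star v

lemma det_diagonal_add_vecMulVec (j : Fin n) (a c : ℝ) (v : Fin n → ℝ) :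
    (Matrix.diagonal (fun i => if i = j then 0 else a) + c • Matrix.vecMulVec v v).det =
      a ^ (n - 1) * (c * v j ^ 2) := by
  set A : Matrix (Fin n) (Fin n) ℝ := Matrix.updateRow 1 j v with hA
  have hdet : A.det = v j := by
    have := Matrix.cramer_transpose_apply (1 : Matrix (Fin n) (Fin n) ℝ) v j
    rw [hA, ← this, Matrix.transpose_one, Matrix.cramer_one]
    rfl
  have hdiag : (Matrix.diagonal (fun i => if i = j then c else a)).det = c * a ^ (n - 1) := by
    rw [Matrix.det_diagonal, ← Finset.mul_prod_erase _ _ (Finset.mem_univ j), if_pos rfl,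
      Finset.prod_congr rfl (g := fun _ => a)
        (fun i hi => if_neg (Finset.ne_of_mem_erase hi))]
    simp
  have hfac : Matrix.diagonal (fun i => if i = j then 0 else a) + c • Matrix.vecMulVec v v =
      A.transpose * Matrix.diagonal (fun i => if i = j then c else a) * A := by
    ext r s
    rw [Matrix.mul_apply, ← Finset.add_sum_erase _ _ (Finset.mem_univ j)]
    have : ∀ i ∈ Finset.univ.erase j,
        (A.transpose * Matrix.diagonal (fun i => if i = j then c else a)) r i * A i s =
          if i = r then (if r = s then a else 0) else 0 := by
      intro i hi
      have hi' := Finset.ne_of_mem_erase hi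
      rw [Matrix.mul_diagonal]
      by_cases h1 : i = r <;> by_cases h2 : i = s <;>
        simp_all [Matrix.updateRow_apply]
    rw [Finset.sum_congr rfl this, Finset.sum_ite_eq', Matrix.mul_diagonal]
    by_cases h1 : r = j <;> by_cases h2 : r = s <;>
      simp_all [Matrix.updateRow_apply, Matrix.vecMulVec_apply] <;> ring
  rw [hfac, Matrix.det_mul, Matrix.det_mul, Matrix.det_transpose, hdet, hdiag]
  ring

lemma add_sq_le_sqrt {s h s₀ h₀ W P q k a b : ℝ} (hW : 0 < W) (hW2 : W ^ 2 = s₀ ^ 2 + h₀ ^ 2)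
    (ha : a = (s * s₀ + P * h₀) / W) (hb : b = (P * s₀ - s * h₀) / W)
    (hP : 0 ≤ P) (hq : 0 ≤ q) (hh : P + q ≤ h)
    (h1 : 2 * k * a + k ^ 2 * b ^ 2 ≤ 1) (h2 : a + k * b ^ 2 ≤ 2 * P) :
    a + k * b ^ 2 + q / 2 ≤ √(s ^ 2 + h ^ 2) := by
  have hab : a ^ 2 + b ^ 2 = s ^ 2 + P ^ 2 := by
    have : a ^ 2 + b ^ 2 = (s ^ 2 + P ^ 2) * (s₀ ^ 2 + h₀ ^ 2) / W ^ 2 := by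
      rw [ha, hb]; field_simp; ring
    rw [this, ← hW2]; field_simp
  refine Real.le_sqrt_of_sq_le ?_
  have e1 : (P + q) ^ 2 ≤ h ^ 2 := pow_le_pow_left₀ (by positivity) hh 2
  have e2 : b ^ 2 * (2 * k * a + k ^ 2 * b ^ 2) ≤ b ^ 2 * 1 :=
    mul_le_mul_of_nonneg_left h1 (sq_nonneg b)
  have e3 : q * (a + k * b ^ 2) ≤ q * (2 * P) := mul_le_mul_of_nonneg_left h2 hq
  nlinarith [sq_nonneg q]

/-- The sum of the squares of all coordinates but the `j`-th. -/
def crossSq (j : Fin n) (x : E n) : ℝ := ∑ i, (if i = j then 0 else 1) * x i ^ 2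

lemma crossSq_nonneg (j : Fin n) (x : E n) : 0 ≤ crossSq j x :=
  Finset.sum_nonneg fun i _ => by split_ifs <;> positivity

lemma crossSq_le_norm_sq (j : Fin n) (x : E n) : crossSq j x ≤ ‖x‖ ^ 2 := by
  rw [EuclideanSpace.norm_sq_eq, crossSq]
  refine Finset.sum_le_sum fun i _ => ?_
  split_ifs <;> simp [sq_nonneg]

lemma continuous_crossSq (j : Fin n) : Continuous (crossSq j) := by
  unfold crossSq; fun_prop

lemma crossSq_eq (j : Fin n) (x x₀ : E n) :
    crossSq j x = crossSq j x₀ + 2 * ∑ i, (if i = j then 0 else 1) * x₀ i * (x i - x₀ i) +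
      ∑ i, (if i = j then 0 else 1) * (x i - x₀ i) ^ 2 := by
  simp only [crossSq, Finset.mul_sum, ← Finset.sum_add_distrib]
  exact Finset.sum_congr rfl fun i _ => by ring

/-- The value of the barrier (up to its additive constant) on the hyperplane `x j = 0`. -/
def barrierHeight (j : Fin n) (A B K : ℝ) (x : E n) (t : ℝ) : ℝ :=
  A * Real.exp (B * t + K / 2 * crossSq j x)

/-- The smoothed angle `√((x j / 2)² + h²) - δ`, where `h` is `barrierHeight`. -/
def barrier (j : Fin n) (A B K δ : ℝ) (x : E n) (t : ℝ) : ℝ :=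
  √((x j / 2) ^ 2 + barrierHeight j A B K x t ^ 2) - δ

lemma barrierHeight_ge (j : Fin n) {A : ℝ} (B K : ℝ) (hA : 0 ≤ A) (x x₀ : E n) (t t₀ : ℝ) :
    barrierHeight j A B K x₀ t₀ *
        (1 + K * ∑ i, (if i = j then 0 else 1) * x₀ i * (x i - x₀ i) + B * (t - t₀)) +
      barrierHeight j A B K x₀ t₀ * K / 2 * ∑ i, (if i = j then 0 else 1) * (x i - x₀ i) ^ 2 ≤
    barrierHeight j A B K x t := by
  set S := ∑ i, (if i = j then 0 else 1) * x₀ i * (x i - x₀ i)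
  set Q := ∑ i, (if i = j then 0 else 1) * (x i - x₀ i) ^ 2
  have he := Real.add_one_le_exp (K * S + B * (t - t₀) + K / 2 * Q)
  have hx : barrierHeight j A B K x t =
      barrierHeight j A B K x₀ t₀ * Real.exp (K * S + B * (t - t₀) + K / 2 * Q) := by
    rw [barrierHeight, barrierHeight, mul_assoc, ← Real.exp_add, crossSq_eq j x x₀]
    congr 2
    ring
  have h0 : 0 ≤ barrierHeight j A B K x₀ t₀ := mul_nonneg hA (Real.exp_pos _).le
  rw [hx]
  nlinarith [mul_le_mul_of_nonneg_left he h0]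

/-- The differential inequality forced on a supersolution touching the barrier from above. -/
lemma ViscSupersolution.contact {lam p T τ A B K δ : ℝ} {Ω : Set (E n)} {u : E n → ℝ → ℝ}
    (hsuper : ViscSupersolution lam p Ω 0 T u) (j : Fin n) (hA : 0 < A) (hK : 0 ≤ K)
    (hτ : τ ≤ T) {x₀ : E n} {t₀ : ℝ} (hx₀ : x₀ ∈ Ω) (ht₀ : t₀ ∈ Ioc 0 τ)
    (hmin : ∀ x ∈ closure Ω, ∀ t ∈ Icc 0 τ,
      u x₀ t₀ - barrier j A B K δ x₀ t₀ ≤ u x t - barrier j A B K δ x t)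
    {h₀ W : ℝ} (hh₀ : h₀ = barrierHeight j A B K x₀ t₀)
    (hW : W = √((x₀ j / 2) ^ 2 + h₀ ^ 2)) (hWh : W < 2 * h₀) :
    lam * ((h₀ * K / 2) ^ (n - 1) * (h₀ ^ 2 / (6 * W ^ 3))) ^ p ≤ h₀ ^ 2 * B / W := by
  have h0 : 0 < h₀ := hh₀ ▸ mul_pos hA (Real.exp_pos _)
  have hW2 : W ^ 2 = (x₀ j / 2) ^ 2 + h₀ ^ 2 := by rw [hW, Real.sq_sqrt (by positivity)]
  have hWpos : 0 < W := by rw [hW]; positivity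
  set s₀ := x₀ j / 2 with hs₀
  set L : E n →L[ℝ] ℝ := ∑ i, ((if i = j then 0 else 1) * x₀ i) • EuclideanSpace.proj i with hL
  set J : E n →L[ℝ] ℝ := EuclideanSpace.proj j with hJ
  have hLx : ∀ y : E n, L y = ∑ i, (if i = j then 0 else 1) * x₀ i * y i := by
    intro y
    simp only [hL, sum_apply, smul_apply, smul_eq_mul]
    rfl
  have hJy : ∀ y : E n, J y = y j := fun _ => rfl
  have hLj : L (EuclideanSpace.single j 1) = 0 := by
    simp [hLx]
  set l : E n →L[ℝ] ℝ := (1 / W) • ((s₀ / 2) • J + (h₀ ^ 2 * K) • L) with hl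
  set m : E n →L[ℝ] ℝ := (1 / W) • ((s₀ * h₀ * K) • L - (h₀ / 2) • J) with hm
  set k := 1 / (3 * W) with hk
  have hkpos : 0 < k := by positivity
  set d : Fin n → ℝ := fun i => if i = j then 0 else h₀ * K / 2 with hd
  set φ := quadTest (W - δ) (h₀ ^ 2 * B / W) (h₀ * B * s₀ / W) k l m d x₀ t₀ with hφ
  have hmj : m (EuclideanSpace.single j 1) = - (h₀ / (2 * W)) := by
    simp [hm, hLj, hJy]; field_simp
  have hhess : hessMatrix φ x₀ t₀ = _ := hessMatrix_quadTest _ _ _ _ _ _ _ _ _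
  have hpsd : (hessMatrix φ x₀ t₀).PosSemidef := by
    rw [hhess]
    refine posSemidef_diagonal_add_vecMulVec (fun i => ?_) (by positivity)
    simp only [hd, Pi.zero_apply]
    split_ifs <;> positivity
  have hdet : (hessMatrix φ x₀ t₀).det =
      (h₀ * K / 2) ^ (n - 1) * (h₀ ^ 2 / (6 * W ^ 3)) := by
    rw [hhess, hd, det_diagonal_add_vecMulVec, hmj, hk]
    congr 1
    field_simp
    norm_num
  rw [← hdet]
  have htd : timeDeriv φ x₀ t₀ = h₀ ^ 2 * B / W := timeDeriv_quadTest _ _ _ _ _ _ _ _ _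
  rw [← htd]
  refine hsuper x₀ hx₀ t₀ ⟨ht₀.1, ht₀.2.trans hτ⟩ φ (isTestAt_quadTest _ _ _ _ _ _ _ _ _)
    ?_ hpsd
  have hφ₀ : φ x₀ t₀ = barrier j A B K δ x₀ t₀ := by
    simp [hφ, quadTest, barrier, ← hh₀, hW, hs₀]
  set P : E n × ℝ → ℝ := fun z => h₀ * (1 + K * L (z.1 - x₀) + B * (z.2 - t₀)) with hP
  set a : E n × ℝ → ℝ := fun z => (z.1 j / 2 * s₀ + P z * h₀) / W with ha
  set b : E n × ℝ → ℝ := fun z => (P z * s₀ - z.1 j / 2 * h₀) / W with hb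
  have hPc : Continuous P := by fun_prop
  have hac : Continuous a := by fun_prop
  have hbc : Continuous b := by fun_prop
  have hP₀ : P (x₀, t₀) = h₀ := by simp [hP]
  have ha₀ : a (x₀, t₀) = W := by
    simp only [ha, hP₀, ← hs₀]
    field_simp
    linarith
  have hb₀ : b (x₀, t₀) = 0 := by
    simp only [hb, hP₀, ← hs₀]
    ring
  have ev1 : ∀ᶠ z in nhds (x₀, t₀), 0 < P z :=
    (hPc.tendsto _).eventually_const_lt (by rwa [hP₀])
  have ev2 : ∀ᶠ z in nhds (x₀, t₀), 2 * k * a z + k ^ 2 * b z ^ 2 < 1 := by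
    have hc : Continuous fun z => 2 * k * a z + k ^ 2 * b z ^ 2 := by fun_prop
    refine (hc.tendsto _).eventually_lt_const ?_
    rw [ha₀, hb₀, hk]
    field_simp
    nlinarith [pow_pos hWpos 2]
  have ev3 : ∀ᶠ z in nhds (x₀, t₀), a z + k * b z ^ 2 - 2 * P z < 0 := by
    have hc : Continuous fun z => a z + k * b z ^ 2 - 2 * P z := by fun_prop
    refine (hc.tendsto _).eventually_lt_const ?_
    rw [ha₀, hb₀, hP₀]
    linarith
  obtain ⟨ε, hε, hev⟩ := Metric.eventually_nhds_iff.1 (ev1.and (ev2.and ev3))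
  refine ⟨ε, hε, fun x hx t ht htt hdx hdt => ?_⟩
  obtain ⟨p1, p2, p3⟩ := @hev (x, t) (by rw [Prod.dist_eq]; exact max_lt hdx hdt)
  have hle : φ x t ≤ barrier j A B K δ x t := by
    have hge := barrierHeight_ge j B K hA.le x x₀ t t₀
    have hq : 0 ≤ h₀ * K / 2 * ∑ i, (if i = j then 0 else 1) * (x i - x₀ i) ^ 2 := by
      refine mul_nonneg (by positivity) (Finset.sum_nonneg fun i _ => ?_)
      split_ifs <;> positivity
    have hmain := add_sq_le_sqrt (s := x j / 2) (h := barrierHeight j A B K x t) (k := k)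
      (a := a (x, t)) (b := b (x, t)) hWpos hW2 rfl rfl p1.le hq
      (by simpa [hP, hLx, ← hh₀] using hge) p2.le (by linarith)
    have e1 : a (x, t) = W + l (x - x₀) + h₀ ^ 2 * B / W * (t - t₀) := by
      simp only [ha, hP, hl, hJy, smul_apply, add_apply, PiLp.sub_apply, smul_eq_mul]
      field_simp
      linear_combination (-2) * hW2 + 2 * s₀ * hs₀
    have e2 : b (x, t) = m (x - x₀) + h₀ * B * s₀ / W * (t - t₀) := by
      simp only [hb, hP, hm, hJy, smul_apply, sub_apply, PiLp.sub_apply, smul_eq_mul]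
      field_simp
      linear_combination (2 * h₀) * hs₀
    have e3 : h₀ * K / 2 * ∑ i, (if i = j then 0 else 1) * (x i - x₀ i) ^ 2 =
        ∑ i, d i * (x i - x₀ i) ^ 2 := by
      rw [Finset.mul_sum]
      refine Finset.sum_congr rfl fun i _ => ?_
      simp only [hd]
      split_ifs <;> ring
    rw [e3, e1, e2] at hmain
    simp only [hφ, quadTest, barrier]
    linarith
  have := hmin x hx t ⟨ht.1, htt.trans ht₀.2⟩
  rw [hφ₀]
  linarith

lemma exists_mul_lt_mul_rpow {m : ℕ} (hm : m ≠ 0) {a lam c : ℝ} (ha : 0 < a) (hlam : 0 < lam)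
    (hc : 0 < c) : ∃ K > 0, K * a < lam * (K ^ (m + 1) / c) ^ ((m : ℝ)⁻¹) := by
  have hr : 0 < c ^ ((m : ℝ)⁻¹) := Real.rpow_pos_of_pos hc _
  set L := a * c ^ ((m : ℝ)⁻¹) / lam + 1 with hL
  have hLpos : 0 < L := by positivity
  have hLa : a * c ^ ((m : ℝ)⁻¹) < lam * L := by
    rw [hL, mul_add, mul_div_cancel₀ _ hlam.ne']
    linarith
  refine ⟨L ^ m, by positivity, ?_⟩
  rw [← pow_mul, mul_comm m, pow_mul, Real.div_rpow (by positivity) hc.le,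
    Real.pow_rpow_inv_natCast (by positivity) hm, mul_div_assoc', lt_div_iff₀ hr]
  calc L ^ m * a * c ^ ((m : ℝ)⁻¹) = L ^ m * (a * c ^ ((m : ℝ)⁻¹)) := by ring
    _ < L ^ m * (lam * L) := by gcongr
    _ = lam * L ^ (m + 1) := by ring

lemma ViscSupersolution.not_contact {m : ℕ} (hm : m ≠ 0) {lam p T τ A B K δ : ℝ}
    {Ω : Set (E (m + 2))} {u : E (m + 2) → ℝ → ℝ} (hsuper : ViscSupersolution lam p Ω 0 T u)
    (hlam : 0 < lam) (hp : 0 ≤ p) (hpm : p ≤ (m : ℝ)⁻¹)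
    (j : Fin (m + 2)) (hA : 0 < A) (hB : 0 ≤ B) (hK : 0 < K)
    (hBK : B < lam * (K ^ (m + 1) / (12 * 2 ^ (m + 1))) ^ ((m : ℝ)⁻¹))
    (hτ : τ ≤ T) {x₀ : E (m + 2)} {t₀ : ℝ} (hx₀ : x₀ ∈ Ω) (ht₀ : t₀ ∈ Ioc 0 τ)
    (hmin : ∀ x ∈ closure Ω, ∀ t ∈ Icc 0 τ,
      u x₀ t₀ - barrier j A B K δ x₀ t₀ ≤ u x t - barrier j A B K δ x t)
    (h1 : barrierHeight j A B K x₀ t₀ ≤ 1)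
    (hG : barrierHeight j A B K x₀ t₀ * (K ^ (m + 1) / (12 * 2 ^ (m + 1))) ≤ 1)
    (hangle : 3 * (x₀ j / 2) ^ 2 ≤ barrierHeight j A B K x₀ t₀ ^ 2) : False := by
  obtain ⟨h₀, hh₀⟩ : ∃ h₀, h₀ = barrierHeight j A B K x₀ t₀ := ⟨_, rfl⟩
  obtain ⟨W, hW⟩ : ∃ W, W = √((x₀ j / 2) ^ 2 + h₀ ^ 2) := ⟨_, rfl⟩
  obtain ⟨G, hGdef⟩ : ∃ G, G = K ^ (m + 1) / (12 * 2 ^ (m + 1)) := ⟨_, rfl⟩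
  rw [← hh₀, ← hGdef] at hG
  rw [← hh₀] at h1 hangle
  rw [← hGdef] at hBK
  have h0 : 0 < h₀ := hh₀ ▸ mul_pos hA (Real.exp_pos _)
  have hG0 : 0 < G := by rw [hGdef]; positivity
  have hWh : h₀ ≤ W := hW ▸ Real.le_sqrt_of_sq_le (by nlinarith [sq_nonneg (x₀ j / 2)])
  have hWpos : 0 < W := h0.trans_le hWh
  have hW2 : W ^ 2 = (x₀ j / 2) ^ 2 + h₀ ^ 2 := by rw [hW, Real.sq_sqrt (by positivity)]
  have hW54 : W ≤ 5 / 4 * h₀ := abs_le_of_sq_le_sq' (by nlinarith) (by positivity) |>.2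
  have hW3 : W ^ 3 ≤ 2 * h₀ ^ 3 := by
    calc W ^ 3 ≤ (5 / 4 * h₀) ^ 3 := by gcongr
      _ ≤ 2 * h₀ ^ 3 := by nlinarith [pow_pos h0 3]
  have hcontact := hsuper.contact j hA hK.le hτ hx₀ ht₀ hmin hh₀ hW (by linarith)
  have hdet : h₀ ^ m * G ≤ (h₀ * K / 2) ^ (m + 2 - 1) * (h₀ ^ 2 / (6 * W ^ 3)) := by
    have e1 : 1 / (12 * h₀) ≤ h₀ ^ 2 / (6 * W ^ 3) := by
      rw [div_le_div_iff₀ (by positivity) (by positivity)]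
      nlinarith
    calc h₀ ^ m * G = (h₀ * K / 2) ^ (m + 1) * (1 / (12 * h₀)) := by
          rw [hGdef, div_pow, mul_pow]; field_simp; ring
      _ ≤ _ := by
          rw [show m + 2 - 1 = m + 1 from rfl]
          gcongr
  have hle1 : h₀ ^ m * G ≤ 1 :=
    (mul_le_mul_of_nonneg_right (pow_le_of_le_one h0.le h1 hm) hG0.le).trans hG
  have hpos : 0 < h₀ ^ m * G := by positivity
  have hrpow : h₀ * G ^ ((m : ℝ)⁻¹) ≤
      ((h₀ * K / 2) ^ (m + 2 - 1) * (h₀ ^ 2 / (6 * W ^ 3))) ^ p := by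
    calc h₀ * G ^ ((m : ℝ)⁻¹) = (h₀ ^ m * G) ^ ((m : ℝ)⁻¹) := by
          rw [Real.mul_rpow (by positivity) hG0.le, Real.pow_rpow_inv_natCast h0.le hm]
      _ ≤ (h₀ ^ m * G) ^ p := Real.rpow_le_rpow_of_exponent_ge hpos hle1 hpm
      _ ≤ _ := Real.rpow_le_rpow hpos.le hdet hp
  have hlt : h₀ ^ 2 * B / W ≤ h₀ * B := by
    rw [div_le_iff₀ hWpos]
    nlinarith [mul_nonneg (mul_nonneg h0.le hB) (sub_nonneg.2 hWh)]
  nlinarith [mul_le_mul_of_nonneg_left hrpow hlam.le, mul_lt_mul_of_pos_left hBK h0]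

lemma exists_pos_forall_frontier_le {Ω : Set (E n)} (hΩ : Bornology.IsBounded Ω) {f : E n → ℝ}
    (hf : ContinuousOn f (closure Ω)) (hpos : ∀ x ∈ frontier Ω, 0 < f x) :
    ∃ c > 0, ∀ x ∈ frontier Ω, c ≤ f x := by
  have hc : IsCompact (frontier Ω) :=
    hΩ.isCompact_closure.of_isClosed_subset isClosed_frontier frontier_subset_closure
  rcases (frontier Ω).eq_empty_or_nonempty with he | hne
  · exact ⟨1, one_pos, by simp [he]⟩
  · obtain ⟨z, hz, hzmin⟩ := hc.exists_isMinOn hne (hf.mono frontier_subset_closure)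
    exact ⟨f z, hpos z hz, fun x hx => hzmin hx⟩

/-- Proposition 4.5: for `p ≤ 1/(n-2)` supersolutions above an angle
become instantly positive. -/
theorem stmt11 (n : ℕ) (hn : 3 ≤ n) (p lam : ℝ)
    (hp : 0 < p) (hple : p ≤ 1 / ((n : ℝ) - 2)) (hlam : 0 < lam)
    (Ω : Set (E n)) (T : ℝ) (u : E n → ℝ → ℝ)
    (hΩo : IsOpen Ω) (hΩc : Convex ℝ Ω) (hΩb : Bornology.IsBounded Ω)
    (hT : 0 < T)
    (hreg : ParabolicRegular Ω 0 T u)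
    (hsuper : ViscSupersolution lam p Ω 0 T u)
    (hangle : ∀ x ∈ Ω, |x ⟨n-1, by omega⟩| ≤ u x 0)
    (hbdry : ∀ x ∈ frontier Ω, 0 < u x 0) :
    ∀ x ∈ Ω, ∀ t ∈ Ioc 0 T, 0 < u x t := by
  intro y hy τ hτ
  obtain ⟨m, rfl⟩ : ∃ m, n = m + 2 := ⟨n - 2, by omega⟩
  have hm : m ≠ 0 := by omega
  have hpm : p ≤ (m : ℝ)⁻¹ := by
    have e : ((m + 2 : ℕ) : ℝ) - 2 = m := by push_cast; ring
    rwa [e, one_div] at hple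
  set j : Fin (m + 2) := ⟨m + 2 - 1, by omega⟩
  have h0T : (0 : ℝ) ∈ Icc 0 T := ⟨le_rfl, hT.le⟩
  have hcont0 : ContinuousOn (fun x => u x 0) (closure Ω) :=
    hreg.cont.comp (f := fun x : E (m + 2) => (x, (0 : ℝ))) (by fun_prop)
      fun x hx => ⟨hx, h0T⟩
  have hangle' : ∀ x ∈ closure Ω, ∀ t ∈ Icc 0 T, |x j| ≤ u x t := fun x hx t ht =>
    (le_on_closure (f := fun x : E (m + 2) => |x j|) hangle (by fun_prop) hcont0 hx).trans
      (hreg.mono x hx 0 h0T t ht ht.1)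
  obtain ⟨c, hc, hcb⟩ := exists_pos_forall_frontier_le hΩb hcont0 hbdry
  obtain ⟨R, hR, hΩR⟩ := hΩb.closure.subset_closedBall_lt 0 0
  have hN : ∀ x ∈ closure Ω, crossSq j x ≤ R ^ 2 := fun x hx =>
    (crossSq_le_norm_sq j x).trans (by
      have := mem_closedBall_zero_iff.1 (hΩR hx)
      gcongr)
  obtain ⟨K, hK, hBK⟩ := exists_mul_lt_mul_rpow hm (a := R ^ 2 / τ) (c := 12 * 2 ^ (m + 1))
    (div_pos (by positivity) hτ.1) hlam (by positivity)
  set B := K * (R ^ 2 / τ) with hB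
  have hBpos : 0 < B := mul_pos hK (div_pos (by positivity) hτ.1)
  have hBτ : B * τ = K * R ^ 2 := by rw [hB]; have := hτ.1.ne'; field_simp
  set G := K ^ (m + 1) / (12 * 2 ^ (m + 1)) with hG
  have hGpos : 0 < G := by positivity
  obtain ⟨ε, hε, hεc, hε1, hεG⟩ : ∃ ε > 0, ε ≤ c / 4 ∧ ε ≤ 1 ∧ ε ≤ 1 / G :=
    ⟨min (c / 4) (min 1 (1 / G)), by positivity, min_le_left _ _,
      (min_le_right _ _).trans (min_le_left _ _), (min_le_right _ _).trans (min_le_right _ _)⟩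
  set A := ε * Real.exp (-(B * τ + K / 2 * R ^ 2)) with hA
  have hApos : 0 < A := by positivity
  set δ := A * Real.exp (K / 2 * R ^ 2) with hδ
  have hhε : ∀ x ∈ closure Ω, ∀ t ∈ Icc 0 τ, barrierHeight j A B K x t ≤ ε := by
    intro x hx t ht
    have h1 : B * t + K / 2 * crossSq j x ≤ B * τ + K / 2 * R ^ 2 := by
      have := hN x hx
      have := ht.2
      gcongr
    calc barrierHeight j A B K x t ≤ A * Real.exp (B * τ + K / 2 * R ^ 2) := by
          unfold barrierHeight; gcongr
      _ = ε := by rw [hA, mul_assoc, ← Real.exp_add]; simp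
  have hh0 : ∀ x t, 0 < barrierHeight j A B K x t := fun x t => mul_pos hApos (Real.exp_pos _)
  have hbar_le : ∀ x t, barrier j A B K δ x t ≤ |x j| / 2 + barrierHeight j A B K x t - δ := by
    intro x t
    have : √((x j / 2) ^ 2 + barrierHeight j A B K x t ^ 2) ≤
        |x j| / 2 + barrierHeight j A B K x t := by
      refine Real.sqrt_le_iff.2 ⟨add_nonneg (by positivity) (hh0 x t).le, ?_⟩
      nlinarith [sq_abs (x j), mul_nonneg (abs_nonneg (x j)) (hh0 x t).le]
    unfold barrier
    linarith
  have hbar_cont : Continuous fun q : E (m + 2) × ℝ => barrier j A B K δ q.1 q.2 := by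
    have := continuous_crossSq j
    unfold barrier barrierHeight
    fun_prop
  have hcomp : ∀ x ∈ closure Ω, ∀ t ∈ Icc 0 τ, barrier j A B K δ x t ≤ u x t := by
    obtain ⟨⟨x₀, t₀⟩, ⟨hx₀, ht₀⟩, hmin⟩ :=
      (hΩb.isCompact_closure.prod (isCompact_Icc (a := 0) (b := τ))).exists_isMinOn
        ⟨(y, τ), subset_closure hy, hτ.1.le, le_rfl⟩
        ((hreg.cont.mono (prod_mono_right (Icc_subset_Icc_right hτ.2))).sub
          hbar_cont.continuousOn)
    have hmin' : ∀ x ∈ closure Ω, ∀ t ∈ Icc 0 τ,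
        u x₀ t₀ - barrier j A B K δ x₀ t₀ ≤ u x t - barrier j A B K δ x t :=
      fun x hx t ht => hmin (show (x, t) ∈ closure Ω ×ˢ Icc 0 τ from ⟨hx, ht⟩)
    by_contra! ⟨x, hx, t, ht, hlt⟩
    have hneg : u x₀ t₀ < barrier j A B K δ x₀ t₀ := by
      have := hmin' x hx t ht
      linarith
    dsimp only at hx₀ ht₀
    have hx₀t₀ : t₀ ∈ Icc 0 T := ⟨ht₀.1, ht₀.2.trans hτ.2⟩
    have hu := hangle' x₀ hx₀ t₀ hx₀t₀
    have hble := hbar_le x₀ t₀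
    have hhle := hhε x₀ hx₀ t₀ ht₀
    have hδpos : 0 < δ := by positivity
    have ht₀pos : 0 < t₀ := by
      refine ht₀.1.lt_of_ne fun h => ?_
      have : barrierHeight j A B K x₀ t₀ ≤ δ := by
        have := hN x₀ hx₀
        rw [barrierHeight, ← h, mul_zero, zero_add, hδ]
        gcongr
      have := abs_nonneg (x₀ j)
      linarith
    have hx₀Ω : x₀ ∈ Ω := by
      by_contra hnot
      have hfr : x₀ ∈ frontier Ω := by
        rw [hΩo.frontier_eq]; exact ⟨hx₀, hnot⟩
      have := (hcb x₀ hfr).trans (hreg.mono x₀ hx₀ 0 h0T t₀ hx₀t₀ ht₀.1)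
      linarith
    refine hsuper.not_contact hm hlam hp.le hpm j hApos hBpos.le hK hBK hτ.2 hx₀Ω
      ⟨ht₀pos, ht₀.2⟩ hmin' (hhle.trans hε1) ?_ ?_
    · calc _ ≤ 1 / G * G := by gcongr; exact hhle.trans hεG
        _ = 1 := by field_simp
    · have hs : |x₀ j| ≤ √((x₀ j / 2) ^ 2 + barrierHeight j A B K x₀ t₀ ^ 2) := by
        unfold barrier at hneg
        linarith
      have := (Real.le_sqrt (abs_nonneg _) (by positivity)).1 hs
      rw [sq_abs] at this
      linarith
  refine lt_of_lt_of_le ?_ (hcomp y (subset_closure hy) τ ⟨hτ.1.le, le_rfl⟩)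
  rw [barrier, sub_pos]
  calc δ < A * Real.exp (B * τ) := by
        rw [hδ, hBτ]
        gcongr
        nlinarith [mul_pos hK (pow_pos hR 2)]
    _ ≤ barrierHeight j A B K y τ := by
        have := mul_nonneg hK.le (crossSq_nonneg j y)
        unfold barrierHeight
        gcongr
        linarith
    _ ≤ _ := Real.le_sqrt_of_sq_le (by nlinarith [sq_nonneg (y j / 2)])
end
end

section
/- Let 0 < p ≤ 1/n and let u be a viscosity supersolution of u_t ≥ λ (det D²u)^p in Ω × [0,T], continuous on Ω̄ × [0,T]. If u(x,0) ≥ 0 for all x ∈ Ω and u(x,0) > 0 for all x ∈ ∂Ω, then u(x,t) > 0 for every x ∈ Ω and every t ∈ (0,T]. -/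
open Set Metric MeasureTheory
open scoped RealInnerProductSpace

noncomputable section

variable {n : ℕ}

/-- The Gaussian-type barrier `ε (exp (M (|x - y|² / 2 - k + c t)) - 1)`. -/
def expBarrier (ε M k c : ℝ) (y x : E n) (t : ℝ) : ℝ :=
  ε * (Real.exp (M * (‖x - y‖ ^ 2 / 2 - k + c * t)) - 1)

theorem continuous_expBarrier_uncurry (ε M k c : ℝ) (y : E n) :
    Continuous fun q : E n × ℝ => expBarrier ε M k c y q.1 q.2 := by
  unfold expBarrier
  fun_prop

theorem isTestAt_expBarrier (ε M k c : ℝ) (y x₀ : E n) (t₀ : ℝ) :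
    IsTestAt (expBarrier ε M k c y) x₀ t₀ := by
  refine ⟨1, one_pos, fun t _ => ContDiff.contDiffOn ?_, fun x _ => ContDiff.contDiffOn ?_⟩
  · have h : ContDiff ℝ 2 (fun x : E n => ‖x - y‖ ^ 2) :=
      (contDiff_id.sub contDiff_const).norm_sq ℝ
    unfold expBarrier
    fun_prop
  · unfold expBarrier
    fun_prop

theorem timeDeriv_expBarrier (ε M k c : ℝ) (y x : E n) (t : ℝ) :
    timeDeriv (expBarrier ε M k c y) x t =
      ε * Real.exp (M * (‖x - y‖ ^ 2 / 2 - k + c * t)) * M * c := by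
  have h : HasDerivAt (fun s : ℝ => M * (‖x - y‖ ^ 2 / 2 - k + c * s)) (M * (c * 1)) t :=
    (((hasDerivAt_id t).const_mul c).const_add _).const_mul M
  have h' := ((h.exp.sub_const 1).const_mul ε).deriv
  unfold timeDeriv expBarrier
  rw [h']
  ring

theorem hasFDerivAt_exp_norm_sq (M b : ℝ) (y x : E n) :
    HasFDerivAt (fun z : E n => Real.exp (M * (‖z - y‖ ^ 2 / 2 + b)))
      ((Real.exp (M * (‖x - y‖ ^ 2 / 2 + b)) * M) • innerSL ℝ (x - y)) x := by
  have h : HasFDerivAt (fun z : E n => ‖z - y‖ ^ 2) _ x :=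
    ((hasFDerivAt_id x).sub_const y).norm_sq
  simp only [div_eq_inv_mul]
  refine (((h.const_mul 2⁻¹).add_const b).const_mul M).exp.congr_fderiv ?_
  ext z
  simp [-mul_eq_mul_left_iff]
  ring

theorem hessMatrix_expBarrier (ε M k c : ℝ) (y x : E n) (t : ℝ) :
    hessMatrix (expBarrier ε M k c y) x t =
      (ε * Real.exp (M * (‖x - y‖ ^ 2 / 2 - k + c * t)) * M) •
        (1 + M • Matrix.vecMulVec (fun i => (x - y) i) (fun i => (x - y) i)) := by
  have hb (z : E n) : ‖z - y‖ ^ 2 / 2 - k + c * t = ‖z - y‖ ^ 2 / 2 + (c * t - k) := by ring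
  have hfd (j : Fin n) (z : E n) :
      fderiv ℝ (fun z => expBarrier ε M k c y z t) z (EuclideanSpace.single j (1 : ℝ)) =
        ε * (Real.exp (M * (‖z - y‖ ^ 2 / 2 + (c * t - k))) * (M * (z - y) j)) := by
    unfold expBarrier
    simp only [hb]
    rw [(((hasFDerivAt_exp_norm_sq M (c * t - k) y z).sub_const 1).const_mul ε).fderiv]
    simp [EuclideanSpace.inner_single_right, -mul_eq_mul_left_iff]
    ring
  ext i j
  simp only [hessMatrix, Matrix.of_apply, hfd, hb]
  have hexp := hasFDerivAt_exp_norm_sq M (c * t - k) y x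
  have hcoord : HasFDerivAt (fun z : E n => (z - y) j) (EuclideanSpace.proj j : E n →L[ℝ] ℝ) x := by
    simpa using ((EuclideanSpace.proj j : E n →L[ℝ] ℝ).hasFDerivAt (x := x)).sub_const (y j)
  have hprod : HasFDerivAt (fun z : E n => ε * (Real.exp (M * (‖z - y‖ ^ 2 / 2 + (c * t - k))) *
      (M * (z - y) j))) _ x := (hexp.mul (hcoord.const_mul M)).const_mul ε
  rw [hprod.fderiv, Matrix.smul_apply, Matrix.add_apply, Matrix.smul_apply,
    Matrix.vecMulVec_apply]
  rcases eq_or_ne i j with rfl | hij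
  · simp [EuclideanSpace.inner_single_right, -mul_eq_mul_left_iff]
    ring
  · simp [EuclideanSpace.inner_single_right, Matrix.one_apply_ne hij,
      -mul_eq_mul_left_iff, hij.symm]
    ring

theorem det_one_add_smul_vecMulVec_self (M : ℝ) (v : E n) :
    (1 + M • Matrix.vecMulVec (fun i => v i) (fun i => v i)).det = 1 + M * ‖v‖ ^ 2 := by
  rw [← Matrix.smul_vecMulVec, Matrix.vecMulVec_eq Unit,
    Matrix.det_one_add_replicateCol_mul_replicateRow, EuclideanSpace.real_norm_sq_eq]
  simp [dotProduct, Finset.mul_sum]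
  refine Finset.sum_congr rfl fun i _ => by ring

theorem det_hessMatrix_expBarrier (ε M k c : ℝ) (y x : E n) (t : ℝ) :
    (hessMatrix (expBarrier ε M k c y) x t).det =
      (ε * Real.exp (M * (‖x - y‖ ^ 2 / 2 - k + c * t)) * M) ^ n * (1 + M * ‖x - y‖ ^ 2) := by
  rw [hessMatrix_expBarrier, Matrix.det_smul, det_one_add_smul_vecMulVec_self, Fintype.card_fin]

theorem posSemidef_hessMatrix_expBarrier {ε M : ℝ} (hε : 0 ≤ ε) (hM : 0 ≤ M) (k c : ℝ)
    (y x : E n) (t : ℝ) : (hessMatrix (expBarrier ε M k c y) x t).PosSemidef := by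
  rw [hessMatrix_expBarrier]
  refine Matrix.PosSemidef.smul (Matrix.PosSemidef.one.add (Matrix.PosSemidef.smul ?_ hM))
    (by positivity)
  simpa using Matrix.posSemidef_vecMulVec_self_star (fun i => (x - y) i)

/-- The barrier is a strict subsolution as long as its speed `c` is below `lam * M ^ p`, its size
is small, and its centre stays at distance at least `1`. -/
theorem timeDeriv_expBarrier_lt {p lam ε M k c : ℝ} (hn : 1 ≤ n) (hp : 0 < p)
    (hple : p ≤ 1 / (n : ℝ)) (hlam : 0 < lam) (hε : 0 < ε) (hM : 0 < M)
    (hc : c < lam * M ^ p) {y x : E n} {t : ℝ} (hxy : 1 ≤ ‖x - y‖)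
    (hsmall : ε * Real.exp (M * (‖x - y‖ ^ 2 / 2 - k + c * t)) * M ≤ 1) :
    timeDeriv (expBarrier ε M k c y) x t <
      lam * (hessMatrix (expBarrier ε M k c y) x t).det ^ p := by
  rw [timeDeriv_expBarrier, det_hessMatrix_expBarrier]
  set a := ε * Real.exp (M * (‖x - y‖ ^ 2 / 2 - k + c * t)) * M
  have ha : 0 < a := by positivity
  have hn' : (0 : ℝ) < n := by exact_mod_cast hn
  have hnp : (n : ℝ) * p ≤ 1 := by
    rw [le_div_iff₀ hn'] at hple
    linarith
  have hpow : a ≤ (a ^ n) ^ p := by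
    rw [← Real.rpow_natCast, ← Real.rpow_mul ha.le]
    simpa using Real.rpow_le_rpow_of_exponent_ge ha hsmall hnp
  have hbase : M ^ p ≤ (1 + M * ‖x - y‖ ^ 2) ^ p :=
    Real.rpow_le_rpow hM.le (by nlinarith [one_le_pow₀ hxy (n := 2)]) hp.le
  rw [Real.mul_rpow (by positivity) (by positivity)]
  calc a * c < a * (lam * M ^ p) := by gcongr
    _ = lam * (a * M ^ p) := by ring
    _ ≤ _ := by gcongr

/-- Comparison of a supersolution with a strict classical subsolution. -/
theorem le_of_viscSupersolution_of_strict {p lam T : ℝ} {Ω : Set (E n)} {u φ : E n → ℝ → ℝ}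
    (hΩo : IsOpen Ω) (hΩb : Bornology.IsBounded Ω)
    (hu : ContinuousOn (fun q : E n × ℝ => u q.1 q.2) (closure Ω ×ˢ Icc 0 T))
    (hsuper : ViscSupersolution lam p Ω 0 T u)
    (hφ : Continuous fun q : E n × ℝ => φ q.1 q.2)
    (htest : ∀ x ∈ Ω, ∀ t ∈ Ioc 0 T, IsTestAt φ x t)
    (hpsd : ∀ x ∈ Ω, ∀ t ∈ Ioc 0 T, (hessMatrix φ x t).PosSemidef)
    (hstrict : ∀ x ∈ Ω, ∀ t ∈ Ioc 0 T,
      timeDeriv φ x t < lam * (hessMatrix φ x t).det ^ p)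
    (hinit : ∀ x ∈ closure Ω, φ x 0 ≤ u x 0)
    (hlat : ∀ x ∈ frontier Ω, ∀ t ∈ Icc 0 T, φ x t ≤ u x t) :
    ∀ x ∈ closure Ω, ∀ t ∈ Icc 0 T, φ x t ≤ u x t := by
  intro x hx t ht
  obtain ⟨⟨x₀, t₀⟩, ⟨hx₀, ht₀⟩, hmin⟩ :=
    (hΩb.isCompact_closure.prod isCompact_Icc).exists_isMinOn ⟨(x, t), hx, ht⟩
      (hu.sub hφ.continuousOn)
  have hmin' : ∀ x' ∈ closure Ω, ∀ t' ∈ Icc 0 T, u x₀ t₀ - φ x₀ t₀ ≤ u x' t' - φ x' t' :=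
    fun x' hx' t' ht' => hmin (a := (x', t')) ⟨hx', ht'⟩
  suffices φ x₀ t₀ ≤ u x₀ t₀ by linarith [hmin' x hx t ht]
  simp only at hx₀ ht₀
  by_cases hxf : x₀ ∈ frontier Ω
  · exact hlat x₀ hxf t₀ ht₀
  have hxΩ : x₀ ∈ Ω := by
    by_contra h
    exact hxf (by rw [hΩo.frontier_eq]; exact ⟨hx₀, h⟩)
  rcases ht₀.1.eq_or_lt with h0 | h0
  · rw [← h0]
    exact hinit x₀ hx₀
  have ht₀' : t₀ ∈ Ioc 0 T := ⟨h0, ht₀.2⟩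
  exact absurd (hsuper x₀ hxΩ t₀ ht₀' φ (htest x₀ hxΩ t₀ ht₀')
    ⟨1, one_pos, fun x' hx' t' ht' _ _ _ => hmin' x' hx' t' ht'⟩ (hpsd x₀ hxΩ t₀ ht₀'))
    (hstrict x₀ hxΩ t₀ ht₀').not_ge

/-- A bounded set lies at distance between `1` and some `D` from a suitable point. -/
theorem exists_center_of_isBounded (hn : 1 ≤ n) {S : Set (E n)} (hS : Bornology.IsBounded S) :
    ∃ (y : E n) (D : ℝ), ∀ x ∈ S, 1 ≤ ‖x - y‖ ∧ ‖x - y‖ ≤ D := by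
  obtain ⟨R, hR0, hR⟩ := hS.exists_pos_norm_le
  have hy : ‖EuclideanSpace.single (⟨0, hn⟩ : Fin n) (R + 1)‖ = R + 1 := by
    rw [PiLp.norm_single, Real.norm_of_nonneg (by positivity)]
  refine ⟨EuclideanSpace.single ⟨0, hn⟩ (R + 1), R + (R + 1), fun x hx => ⟨?_, ?_⟩⟩
  · rw [norm_sub_rev]
    linarith [norm_sub_norm_le (EuclideanSpace.single (⟨0, hn⟩ : Fin n) (R + 1)) x, hR x hx]
  · linarith [norm_sub_le x (EuclideanSpace.single (⟨0, hn⟩ : Fin n) (R + 1)), hR x hx]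

theorem IsCompact.exists_pos_le_of_continuousOn {X : Type*} [TopologicalSpace X] {K : Set X}
    (hK : IsCompact K) {f : X → ℝ} (hf : ContinuousOn f K) (hpos : ∀ x ∈ K, 0 < f x) :
    ∃ δ > 0, ∀ x ∈ K, δ ≤ f x := by
  rcases K.eq_empty_or_nonempty with rfl | hne
  · exact ⟨1, one_pos, by simp⟩
  · obtain ⟨x₀, hx₀, hmin⟩ := hK.exists_isMinOn hne hf
    exact ⟨f x₀, hpos x₀ hx₀, fun x hx => hmin hx⟩

/-- Proposition 4.4: for `p ≤ 1/n` nonnegative supersolutions become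
instantly positive. -/
theorem stmt12 (n : ℕ) (hn : 1 ≤ n) (p lam : ℝ)
    (hp : 0 < p) (hple : p ≤ 1 / (n : ℝ)) (hlam : 0 < lam)
    (Ω : Set (E n)) (T : ℝ) (u : E n → ℝ → ℝ)
    (hΩo : IsOpen Ω) (hΩc : Convex ℝ Ω) (hΩb : Bornology.IsBounded Ω)
    (hT : 0 < T)
    (hreg : ParabolicRegular Ω 0 T u)
    (hsuper : ViscSupersolution lam p Ω 0 T u)
    (hnonneg : ∀ x ∈ Ω, 0 ≤ u x 0)
    (hbdry : ∀ x ∈ frontier Ω, 0 < u x 0) :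
    ∀ x ∈ Ω, ∀ t ∈ Ioc 0 T, 0 < u x t := by
  intro x hx t ht
  obtain ⟨y, D, hyD⟩ := exists_center_of_isBounded hn hΩb.closure
  have h0T : (0 : ℝ) ∈ Icc 0 T := ⟨le_rfl, hT.le⟩
  have hfc : frontier Ω ⊆ closure Ω := frontier_subset_closure
  have hcont0 : ContinuousOn (fun z => u z 0) (frontier Ω) :=
    hreg.cont.comp (f := fun z : E n => (z, (0 : ℝ))) (by fun_prop) fun z hz => ⟨hfc hz, h0T⟩
  obtain ⟨δ, hδ, hδu⟩ := (hΩb.isCompact_closure.of_isClosed_subset isClosed_frontier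
    hfc).exists_pos_le_of_continuousOn hcont0 hbdry
  obtain ⟨M, hMt, hM1⟩ : ∃ M : ℝ, D ^ 2 / (lam * t) < M ^ p ∧ 1 ≤ M :=
    (((tendsto_rpow_atTop hp).eventually_gt_atTop _).and
      (Filter.eventually_ge_atTop 1)).exists
  have hM : 0 < M := one_pos.trans_le hM1
  have hlt : 0 < lam * t := mul_pos hlam ht.1
  have hMp : 0 < M ^ p := Real.rpow_pos_of_pos hM p
  set c := lam * M ^ p / 2 with hc
  have hc0 : 0 < c := by positivity
  have hct : D ^ 2 / 2 < c * t := by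
    rw [div_lt_iff₀ hlt] at hMt
    rw [hc]
    linarith
  set B := Real.exp (M * (c * T)) with hB
  have hB0 : 0 < B := Real.exp_pos _
  set ε := min δ 1 / (M * B) with hεdef
  have hε : 0 < ε := by positivity
  have hεB : ε * B * M = min δ 1 := by rw [hεdef]; field_simp
  have hexp : ∀ z ∈ closure Ω, ∀ s ≤ T,
      Real.exp (M * (‖z - y‖ ^ 2 / 2 - D ^ 2 / 2 + c * s)) ≤ B := by
    intro z hz s hs
    have hz2 : ‖z - y‖ ^ 2 ≤ D ^ 2 := pow_le_pow_left₀ (norm_nonneg _) (hyD z hz).2 2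
    have hcs : c * s ≤ c * T := by gcongr
    exact Real.exp_le_exp.2 (mul_le_mul_of_nonneg_left (by linarith) hM.le)
  have hcomp : ∀ z ∈ closure Ω, ∀ s ∈ Icc 0 T, expBarrier ε M (D ^ 2 / 2) c y z s ≤ u z s := by
    refine le_of_viscSupersolution_of_strict hΩo hΩb hreg.cont hsuper
      (continuous_expBarrier_uncurry ..)
      (fun z _ s _ => isTestAt_expBarrier ..)
      (fun z _ s _ => posSemidef_hessMatrix_expBarrier hε.le hM.le ..)
      (fun z hz s hs => ?_) (fun z hz => ?_) (fun z hz s hs => ?_)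
    · have hz' := subset_closure hz
      refine timeDeriv_expBarrier_lt hn hp hple hlam hε hM ?_ (hyD z hz').1 ?_
      · rw [hc]
        linarith [mul_pos hlam hMp]
      · calc _ ≤ ε * B * M := by gcongr; exact hexp z hz' s hs.2
          _ ≤ 1 := hεB.trans_le (min_le_right _ _)
    · have hz2 : ‖z - y‖ ^ 2 ≤ D ^ 2 := pow_le_pow_left₀ (norm_nonneg _) (hyD z hz).2 2
      have hu0 : 0 ≤ u z 0 := by
        by_cases hzΩ : z ∈ Ω
        · exact hnonneg z hzΩ
        · exact (hbdry z (by rw [hΩo.frontier_eq]; exact ⟨hz, hzΩ⟩)).le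
      refine le_trans (mul_nonpos_of_nonneg_of_nonpos hε.le ?_) hu0
      rw [sub_nonpos, Real.exp_le_one_iff]
      exact mul_nonpos_of_nonneg_of_nonpos hM.le (by linarith)
    · calc expBarrier ε M (D ^ 2 / 2) c y z s ≤ ε * B := by
            unfold expBarrier
            gcongr
            linarith [hexp z (hfc hz) s hs.2]
        _ ≤ ε * B * M := le_mul_of_one_le_right (by positivity) hM1
        _ ≤ δ := hεB.trans_le (min_le_left _ _)
        _ ≤ u z 0 := hδu z hz
        _ ≤ u z s := hreg.mono z (hfc hz) 0 h0T s hs hs.1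
  refine lt_of_lt_of_le (mul_pos hε ?_) (hcomp x (subset_closure hx) t ⟨ht.1.le, ht.2⟩)
  rw [sub_pos, Real.one_lt_exp_iff]
  exact mul_pos hM (by linarith [sq_nonneg ‖x - y‖])
end
end

section
/- Let u be a viscosity supersolution of u_t ≥ λ (det D²u)^p in Ω × [0,T], continuous on Ω̄ × [0,T], with 0 ∈ Ω. Let w : ℝ^{n−1} → ℝ satisfy u(x,0) ≥ w(x′) ≥ 0 for all x = (x′, x_n) ∈ Ω, u(0,0) = w(0) = 0, and u(x,0) > 0 for all x ∈ ∂Ω. For h > 0 let a_h denote the (n−1)-dimensional Lebesgue measure of the set {x′ ∈ ℝ^{n−1} : w(x′) < h} ∩ π(Ω), where π : ℝⁿ → ℝ^{n−1} is the projection π(x) = x′ onto the first n−1 coordinates. If there is a sequence h_j → 0 with a_{h_j}^{2p} / h_j^{np−1} → 0, then u(0,t) > 0 for every t ∈ (0,T]. -/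
open Set Metric MeasureTheory
open scoped RealInnerProductSpace

noncomputable section

variable {n : ℕ}

/-- Projection of `ℝⁿ` onto the first `n-1` coordinates. -/
noncomputable def projSlice (n : ℕ) (x : E n) : E (n-1) :=
  (EuclideanSpace.equiv (Fin (n-1)) ℝ).symm fun j => x ⟨j, lt_of_lt_of_le j.2 (Nat.sub_le n 1)⟩

/-- A compact convex neighbourhood of the origin lies in a parallelotope of comparable volume. -/
theorem exists_matrix_norm_sq_le_and_volume {n : ℕ} {K : Set (E n)} (hK : IsCompact K)
    (hconv : Convex ℝ K) {ε : ℝ} (hε : 0 < ε) (hball : closedBall (0 : E n) ε ⊆ K) :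
    ∃ A : Matrix (Fin n) (Fin n) ℝ, A.det ≠ 0 ∧
      (∀ x ∈ K, ‖Matrix.toLpLin 2 2 A x‖ ^ 2 ≤ n) ∧
      1 ≤ |A.det| * (n : ℝ) ^ n * (volume K).toReal := by
  have h0K : (0 : E n) ∈ K := hball (mem_closedBall_self hε.le)
  set N : (Fin n → E n) → Matrix (Fin n) (Fin n) ℝ := fun x => Matrix.of fun i j => x i j with hN
  have hcont : Continuous fun x : Fin n → E n => |(N x).det| := by
    refine (Continuous.matrix_det ?_).abs
    refine continuous_matrix fun i j => ?_
    simp only [hN, Matrix.of_apply]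
    fun_prop
  obtain ⟨x, hxK, hmax⟩ := (isCompact_univ_pi fun _ : Fin n => hK).exists_isMaxOn
    ⟨fun _ => 0, fun _ _ => h0K⟩ hcont.continuousOn
  have hdet : 0 < |(N x).det| := by
    have hmem : (fun i => EuclideanSpace.single i ε : Fin n → E n) ∈ Set.univ.pi fun _ => K := by
      intro i _
      apply hball
      simp [abs_of_pos hε]
    have h := hmax hmem
    have hNe : N (fun i => EuclideanSpace.single i ε) = Matrix.diagonal fun _ => ε := by
      ext i j
      simp [hN, Matrix.diagonal_apply, eq_comm]
    simp only [mem_ofPred_eq, hNe, Matrix.det_diagonal, Finset.prod_const] at h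
    exact lt_of_lt_of_le (abs_pos.2 (pow_ne_zero _ hε.ne')) h
  have hdet0 : (N x).det ≠ 0 := abs_pos.1 hdet
  have hunit : IsUnit (N x).transpose.det := by
    rw [Matrix.det_transpose]; exact hdet0.isUnit
  have hcoord : ∀ y ∈ K, ∀ i, |((N x).transpose⁻¹.mulVec y.ofLp) i| ≤ 1 := by
    intro y hy i
    have hmem : Function.update x i y ∈ Set.univ.pi fun _ => K := by
      intro j _
      by_cases hj : j = i
      · subst hj; simpa using hy
      · simpa [hj] using hxK j trivial
    have h := hmax hmem
    have hNu : N (Function.update x i y) = (N x).updateRow i y.ofLp := by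
      ext a b
      by_cases ha : a = i
      · subst ha; simp [hN]
      · simp [hN, ha]
    have hc := congrFun (Matrix.det_smul_inv_mulVec_eq_cramer _ y.ofLp hunit) i
    rw [Matrix.cramer_transpose_apply, Matrix.det_transpose, Pi.smul_apply, smul_eq_mul] at hc
    simp only [mem_ofPred_eq, hNu] at h
    rw [← hc, abs_mul] at h
    exact (mul_le_iff_le_one_right hdet).1 h
  set A := (N x).transpose⁻¹ with hA
  have hAdet : A.det ≠ 0 := by
    rw [hA, Matrix.det_nonsing_inv]
    exact (isUnit_ringInverse.2 hunit).ne_zero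
  refine ⟨A, hAdet, ?_, ?_⟩
  · intro y hy
    rw [EuclideanSpace.norm_sq_eq]
    calc ∑ i, ‖(Matrix.toLpLin 2 2 A y).ofLp i‖ ^ 2 ≤ ∑ _i : Fin n, (1 : ℝ) := by
          refine Finset.sum_le_sum fun i _ => ?_
          have := hcoord y hy i
          rw [Matrix.toLpLin_apply, Real.norm_eq_abs]
          exact pow_le_one₀ (abs_nonneg _) this
      _ = n := by simp
  · set Q : Set (E n) :=
      (MeasurableEquiv.toLp 2 (Fin n → ℝ)).symm ⁻¹' Icc (fun _ => 0) (fun _ => 1 / (n : ℝ)) with hQ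
    have hQK : Matrix.toLpLin 2 2 A ⁻¹' Q ⊆ K := by
      intro y hy
      set c := A.mulVec y.ofLp with hc
      have hc0 : ∀ i, 0 ≤ c i := fun i => hy.1 i
      have hc1 : ∀ i, c i ≤ 1 / n := fun i => hy.2 i
      have hyc : y = ∑ i, c i • x i := by
        have h1 : (N x).transpose.mulVec c = y.ofLp := by
          rw [hc, Matrix.mulVec_mulVec, hA, Matrix.mul_nonsing_inv _ hunit, Matrix.one_mulVec]
        ext j
        rw [← h1]
        simp [Matrix.mulVec, dotProduct, hN, mul_comm]
      have hsum : ∑ i, c i ≤ 1 := by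
        rcases Nat.eq_zero_or_pos n with hn | hn
        · subst hn; simp
        · have hn' : (n : ℝ) ≠ 0 := by positivity
          calc ∑ i, c i ≤ ∑ _i : Fin n, 1 / (n : ℝ) := Finset.sum_le_sum fun i _ => hc1 i
            _ = 1 := by simp [hn']
      have h2 := hconv.sum_mem (t := Finset.univ)
        (w := fun o : Option (Fin n) => o.elim (1 - ∑ i, c i) c)
        (z := fun o => o.elim 0 x) ?_ ?_ ?_
      · simpa [Fintype.sum_option, ← hyc] using h2
      · rintro (_ | i) _
        · simpa using hsum
        · exact hc0 i
      · simp [Fintype.sum_option]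
      · rintro (_ | i) _
        · exact h0K
        · exact hxK i trivial
    have hLdet : LinearMap.det (Matrix.toLpLin 2 2 A) = A.det := by
      rw [LinearMap.det_toLpLin]
    have hvol := measure_mono (μ := volume) hQK
    rw [Measure.addHaar_preimage_linearMap _ (by rw [hLdet]; exact hAdet), hLdet, hQ,
      (EuclideanSpace.volume_preserving_symm_measurableEquiv_toLp (Fin n)).measure_preimage_equiv]
      at hvol
    have hvol' := ENNReal.toReal_mono hK.measure_lt_top.ne hvol
    rw [ENNReal.toReal_mul, ENNReal.toReal_ofReal (abs_nonneg _),
      Real.volume_Icc_pi_toReal (fun i => by simp)] at hvol'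
    simp only [sub_zero, Finset.prod_const, Finset.card_univ, Fintype.card_fin, abs_inv] at hvol'
    have hApos := abs_pos.2 hAdet
    have hnn : 0 < (n : ℝ) ^ n := by
      rcases Nat.eq_zero_or_pos n with hn | hn
      · subst hn; simp
      · positivity
    calc (1 : ℝ) = |A.det| * (n : ℝ) ^ n * (|A.det|⁻¹ * (1 / (n : ℝ)) ^ n) := by
          rw [one_div, inv_pow]; field_simp
      _ ≤ _ := by gcongr

/-- The volume of a set is controlled by that of its projection and its width. -/
theorem volume_le_mul_volume_projSlice_image {m : ℕ} {K : Set (E (m + 1))} {R : ℝ}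
    (hKR : K ⊆ closedBall 0 R) :
    volume K ≤ ENNReal.ofReal (2 * R) * volume (projSlice (m + 1) '' K) := by
  set P : Set (E m) := projSlice (m + 1) '' K with hP
  set P' : Set (Fin m → ℝ) := MeasurableEquiv.toLp 2 (Fin m → ℝ) ⁻¹' P with hP'
  have hsub : K ⊆ (MeasurableEquiv.toLp 2 (Fin (m + 1) → ℝ)).symm ⁻¹'
      (MeasurableEquiv.piFinSuccAbove (fun _ => ℝ) (Fin.last m) ⁻¹' (Icc (-R) R ×ˢ P')) := by
    intro x hx
    refine ⟨?_, x, hx, ?_⟩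
    · have h1 : ‖x‖ ≤ R := by simpa using hKR hx
      have h2 : |x (Fin.last m)| ≤ R := (PiLp.norm_apply_le x (Fin.last m)).trans h1
      exact abs_le.1 h2
    · ext j
      simp [projSlice, MeasurableEquiv.piFinSuccAbove, MeasurableEquiv.toLp]
      rfl
  refine (measure_mono hsub).trans ?_
  rw [(EuclideanSpace.volume_preserving_symm_measurableEquiv_toLp _).measure_preimage_equiv,
    (volume_preserving_piFinSuccAbove (fun _ => ℝ) (Fin.last m)).measure_preimage_equiv,
    Measure.volume_eq_prod, Measure.prod_prod, Real.volume_Icc, hP',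
    MeasurePreserving.measure_preimage_equiv (f := MeasurableEquiv.toLp 2 (Fin m → ℝ))
      (PiLp.volume_preserving_toLp (Fin m))]
  exact le_of_eq (by ring_nf)

theorem hessMatrix_quadratic {n : ℕ} (A : Matrix (Fin n) (Fin n) ℝ) (κ c m : ℝ) (x : E n) (t : ℝ) :
    hessMatrix (fun x t => κ * ‖Matrix.toLpLin 2 2 A x‖ ^ 2 + c + m * t) x t =
      (2 * κ) • (A.conjTranspose * A) := by
  set L : E n →L[ℝ] E n := LinearMap.toContinuousLinearMap (Matrix.toLpLin 2 2 A) with hL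
  have hLx : ∀ x, Matrix.toLpLin 2 2 A x = L x := fun _ => rfl
  have hLs : ∀ i k, (L (EuclideanSpace.single i (1 : ℝ))).ofLp k = A k i := by
    intro i k
    simp [hL, Matrix.toLpLin_apply, EuclideanSpace.single]
  have h1 : ∀ y v : E n, fderiv ℝ (fun z => κ * ‖L z‖ ^ 2 + c + m * t) y v
      = 2 * κ * ⟪L v, L y⟫ := by
    intro y v
    have h := ((((L.hasFDerivAt (x := y)).norm_sq).const_mul κ).add_const c).add_const (m * t)
    rw [h.fderiv]
    simp only [smul_apply, ContinuousLinearMap.comp_apply, innerSL_apply_apply, smul_eq_mul,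
      nsmul_eq_mul, Nat.cast_ofNat, real_inner_comm]
    ring
  ext i j
  simp only [hessMatrix, hLx, Matrix.of_apply, h1]
  have h2 : ∀ b : E n, HasFDerivAt (fun y => 2 * κ * ⟪b, L y⟫)
      ((2 * κ) • (innerSL ℝ b).comp L) x := by
    intro b
    exact (((innerSL ℝ b).comp L).hasFDerivAt).const_mul _
  rw [(h2 _).fderiv]
  simp only [smul_apply, ContinuousLinearMap.comp_apply, innerSL_apply_apply,
    Matrix.smul_apply, smul_eq_mul, Matrix.mul_apply, Matrix.conjTranspose_apply,
    EuclideanSpace.inner_eq_star_dotProduct, dotProduct, hLs]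
  simp [hLs, mul_comm]

theorem ParabolicRegular.continuousOn_initial {n : ℕ} {Ω : Set (E n)} {T : ℝ} {u : E n → ℝ → ℝ}
    (hreg : ParabolicRegular Ω 0 T u) (hT : 0 ≤ T) :
    ContinuousOn (fun x => u x 0) (closure Ω) :=
  hreg.cont.comp (f := fun x => (x, (0 : ℝ))) (by fun_prop) fun _ hx => ⟨hx, le_rfl, hT⟩

theorem ParabolicRegular.isCompact_sublevel {n : ℕ} {Ω : Set (E n)} {T : ℝ} {u : E n → ℝ → ℝ}
    (hreg : ParabolicRegular Ω 0 T u) (hT : 0 ≤ T) (hΩb : Bornology.IsBounded Ω) (k : ℝ) :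
    IsCompact {x ∈ closure Ω | u x 0 ≤ k} :=
  hΩb.isCompact_closure.of_isClosed_subset
    ((hreg.continuousOn_initial hT).preimage_isClosed_of_isClosed isClosed_closure isClosed_Iic)
    inter_subset_left

/-- Comparison with a quadratic polynomial rising at constant speed, on a compact sublevel set of
the initial datum. -/
theorem lower_bound_of_sublevel {n : ℕ} (hn : 1 ≤ n) {p lam T k m τ : ℝ} {Ω : Set (E n)}
    {u : E n → ℝ → ℝ} (hΩo : IsOpen Ω) (hΩb : Bornology.IsBounded Ω)
    (hreg : ParabolicRegular Ω 0 T u) (hsuper : ViscSupersolution lam p Ω 0 T u)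
    (hnonneg : ∀ x ∈ closure Ω, 0 ≤ u x 0) (hk : 0 < k)
    (hbdry : ∀ x ∈ frontier Ω, k < u x 0) (h0 : (0 : E n) ∈ Ω) (hu00 : u 0 0 ≤ k)
    (A : Matrix (Fin n) (Fin n) ℝ)
    (hA : ∀ x ∈ closure Ω, u x 0 ≤ k → ‖Matrix.toLpLin 2 2 A x‖ ^ 2 ≤ n)
    (hm : m < lam * ((k / n) ^ n * A.det ^ 2) ^ p) (hτ0 : 0 ≤ τ) (hτT : τ ≤ T)
    (hmτ : ∀ t ∈ Icc 0 τ, m * t ≤ k) :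
    -(k / 2) + m * τ ≤ u 0 τ := by
  have hn0 : (0 : ℝ) < n := by exact_mod_cast hn
  set κ : ℝ := k / (2 * n) with hκ
  have hκ0 : 0 < κ := by positivity
  set φ : E n → ℝ → ℝ := fun x t => κ * ‖Matrix.toLpLin 2 2 A x‖ ^ 2 + -(k / 2) + m * t with hφ
  set K : Set (E n) := {x ∈ closure Ω | u x 0 ≤ k} with hK
  have hT : 0 ≤ T := hτ0.trans hτT
  have hu0 := hreg.continuousOn_initial hT
  have hKc : IsCompact K := hreg.isCompact_sublevel hT hΩb k
  set L : E n →L[ℝ] E n := LinearMap.toContinuousLinearMap (Matrix.toLpLin 2 2 A) with hL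
  have hLx : ∀ x, Matrix.toLpLin 2 2 A x = L x := fun _ => rfl
  have hcontφ : Continuous fun q : E n × ℝ => φ q.1 q.2 := by
    simp only [hφ, hLx]; fun_prop
  have hcont : ContinuousOn (fun q : E n × ℝ => u q.1 q.2 - φ q.1 q.2) (K ×ˢ Icc 0 τ) :=
    (hreg.cont.mono (prod_mono (fun x hx => hx.1) (Icc_subset_Icc le_rfl hτT))).sub
      hcontφ.continuousOn
  have h0K : (0 : E n) ∈ K := ⟨subset_closure h0, hu00⟩
  obtain ⟨⟨x₀, t₀⟩, ⟨hx₀, ht₀⟩, hmin⟩ := (hKc.prod isCompact_Icc).exists_isMinOn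
    ⟨(0, τ), h0K, hτ0, le_rfl⟩ hcont
  change x₀ ∈ K at hx₀
  change t₀ ∈ Icc 0 τ at ht₀
  have hφle : ∀ x ∈ K, ∀ t, φ x t ≤ m * t := by
    intro x hx t
    have h1 := mul_le_mul_of_nonneg_left (hA x hx.1 hx.2) hκ0.le
    have h2 : κ * n = k / 2 := by rw [hκ]; field_simp
    simp only [hφ]
    linarith
  have hmono : u x₀ 0 ≤ u x₀ t₀ :=
    hreg.mono x₀ hx₀.1 0 ⟨le_rfl, hT⟩ t₀ ⟨ht₀.1, ht₀.2.trans hτT⟩ ht₀.1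
  have hkey : 0 ≤ u x₀ t₀ - φ x₀ t₀ := by
    by_contra! hneg
    have hle := hφle x₀ hx₀ t₀
    have hlt : u x₀ 0 < k := by linarith [hmτ t₀ ht₀]
    have ht₀pos : 0 < t₀ := by
      rcases ht₀.1.eq_or_lt with h | h
      · rw [← h, mul_zero] at hle
        rw [← h] at hneg
        linarith [hnonneg x₀ hx₀.1]
      · exact h
    have hx₀Ω : x₀ ∈ Ω := by
      by_contra hx
      exact absurd (hbdry x₀ ⟨hx₀.1, by rwa [hΩo.interior_eq]⟩) (not_lt.2 hlt.le)
    obtain ⟨ε, hε, hεK⟩ : ∃ ε > 0, ∀ x ∈ closure Ω, dist x x₀ < ε → u x 0 < k := by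
      have h := (hu0 x₀ hx₀.1).eventually (gt_mem_nhds hlt)
      obtain ⟨ε, hε, h⟩ := Metric.mem_nhdsWithin_iff.1 h
      exact ⟨ε, hε, fun x hx hd => h ⟨hd, hx⟩⟩
    have hH := hessMatrix_quadratic A κ (-(k / 2)) m x₀ t₀
    have h := hsuper x₀ hx₀Ω t₀ ⟨ht₀pos, ht₀.2.trans hτT⟩ φ ?_ ?_ ?_
    · have hdet : (hessMatrix φ x₀ t₀).det = (k / n) ^ n * A.det ^ 2 := by
        rw [hH, Matrix.det_smul, Matrix.det_mul, Matrix.det_conjTranspose, Fintype.card_fin, hκ]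
        simp only [star_trivial]
        rw [show 2 * (k / (2 * (n : ℝ))) = k / n by field_simp]
        ring
      have hderiv : timeDeriv φ x₀ t₀ = m := by
        have : HasDerivAt (φ x₀) (m * 1) t₀ := ((hasDerivAt_id t₀).const_mul m).const_add _
        rw [timeDeriv, this.deriv, mul_one]
      rw [hdet, hderiv] at h
      linarith
    · refine ⟨1, one_pos, fun t _ => ContDiff.contDiffOn ?_, fun x _ => ContDiff.contDiffOn ?_⟩
      · simp only [hφ, hLx]
        have := L.contDiff (n := 2)
        exact ((contDiff_const.mul (this.norm_sq ℝ)).add contDiff_const).add contDiff_const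
      · simp only [hφ]; fun_prop
    · refine ⟨ε, hε, fun x hx t ht htt hd _ => ?_⟩
      exact hmin (a := (x, t)) ⟨⟨hx, (hεK x hx hd).le⟩, ht.1, htt.trans ht₀.2⟩
    · rw [hH]
      exact (Matrix.posSemidef_conjTranspose_mul_self A).smul (by positivity)
  have hfin := hmin (a := (0, τ)) ⟨h0K, hτ0, le_rfl⟩
  simp only [mem_ofPred_eq] at hfin
  have : φ 0 τ = -(k / 2) + m * τ := by simp [hφ]
  linarith

/-- Corollary 4.2: instantaneous separation from a degenerate profile
`w(x')` of `n-1` variables. -/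
theorem stmt13 (n : ℕ) (hn : 1 ≤ n) (p lam : ℝ)
    (hp : 0 < p) (hlam : 0 < lam)
    (Ω : Set (E n)) (T : ℝ) (u : E n → ℝ → ℝ) (w : E (n-1) → ℝ)
    (hΩo : IsOpen Ω) (hΩc : Convex ℝ Ω) (hΩb : Bornology.IsBounded Ω)
    (hT : 0 < T)
    (hreg : ParabolicRegular Ω 0 T u)
    (hsuper : ViscSupersolution lam p Ω 0 T u)
    (h0 : (0 : E n) ∈ Ω)
    (hw1 : ∀ x ∈ Ω, w (projSlice n x) ≤ u x 0)
    (hw2 : ∀ x ∈ Ω, 0 ≤ w (projSlice n x))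
    (hu00 : u 0 0 = 0) (hw0 : w 0 = 0)
    (hbdry : ∀ x ∈ frontier Ω, 0 < u x 0)
    (hseq : ∃ h : ℕ → ℝ, (∀ j, 0 < h j) ∧
      Filter.Tendsto h Filter.atTop (nhds 0) ∧
      Filter.Tendsto
        (fun j => (volume ({x' : E (n-1) | w x' < h j} ∩ projSlice n '' Ω)).toReal ^ (2 * p) /
          h j ^ ((n : ℝ) * p - 1))
        Filter.atTop (nhds 0)) :
    ∀ t ∈ Ioc 0 T, 0 < u 0 t := by
  obtain ⟨d, rfl⟩ : ∃ d, n = d + 1 := ⟨n - 1, by omega⟩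
  rintro t ⟨ht0, htT⟩
  obtain ⟨h, hpos, hlim, hquot⟩ := hseq
  obtain ⟨δ, hδ, hδle⟩ : ∃ δ > 0, ∀ x ∈ frontier Ω, δ ≤ u x 0 := by
    have hc : IsCompact (frontier Ω) :=
      hΩb.isCompact_closure.of_isClosed_subset isClosed_frontier frontier_subset_closure
    rcases (frontier Ω).eq_empty_or_nonempty with he | hne
    · exact ⟨1, one_pos, by simp [he]⟩
    · obtain ⟨x, hx, hmin⟩ := hc.exists_isMinOn hne
        ((hreg.continuousOn_initial hT.le).mono frontier_subset_closure)
      exact ⟨u x 0, hbdry x hx, fun y hy => hmin hy⟩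
  obtain ⟨R, hR, hΩR⟩ : ∃ R > 0, closure Ω ⊆ closedBall 0 R := by
    obtain ⟨R, hR, h⟩ := hΩb.closure.subset_closedBall_lt 0 0
    exact ⟨R, hR, h⟩
  set C : ℝ := ((d + 1 : ℕ) : ℝ) ^ (d + 1) * (2 * R) with hC
  have hC0 : 0 < C := by positivity
  set N : ℝ := ((d + 1 : ℕ) : ℝ) with hN
  have hN0 : 0 < N := by positivity
  set M : ℝ := ((2 * N) ^ (d + 1) * C ^ 2) ^ p / lam with hM
  have hev := (hlim.eventually (gt_mem_nhds hδ)).and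
    ((hquot.const_mul M).eventually
      (gt_mem_nhds (by simpa using ht0)))
  obtain ⟨j, hjδ, hjt⟩ := hev.exists
  set η := h j with hη
  have hη0 : 0 < η := hpos j
  set S := {x' : E (d + 1 - 1) | w x' < η} ∩ projSlice (d + 1) '' Ω with hS
  set a := (volume S).toReal with ha
  have hnonneg : ∀ x ∈ closure Ω, 0 ≤ u x 0 := by
    intro x hx
    by_cases hxΩ : x ∈ Ω
    · exact (hw2 x hxΩ).trans (hw1 x hxΩ)
    · exact (hbdry x ⟨hx, by rwa [hΩo.interior_eq]⟩).le
  set k := η / 2 with hk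
  have hk0 : 0 < k := by positivity
  have hkbdry : ∀ x ∈ frontier Ω, k < u x 0 := fun x hx => by linarith [hδle x hx]
  set K := {x ∈ closure Ω | u x 0 ≤ k} with hK
  have hKc : IsCompact K := hreg.isCompact_sublevel hT.le hΩb k
  have hKconv : Convex ℝ K := (hreg.conv 0 ⟨le_rfl, hT.le⟩).convex_le k
  obtain ⟨ε, hε, hball⟩ : ∃ ε > 0, closedBall (0 : E (d + 1)) ε ⊆ K := by
    have hcl : closure Ω ∈ nhds (0 : E (d + 1)) :=
      Filter.mem_of_superset (hΩo.mem_nhds h0) subset_closure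
    have hcont := (hreg.continuousOn_initial hT.le).continuousAt hcl
    have hlt := hcont.eventually (gt_mem_nhds (show u 0 0 < k from hu00.trans_lt hk0))
    refine Metric.nhds_basis_closedBall.mem_iff.1 (Filter.mem_of_superset
      (Filter.inter_mem hcl hlt) fun x hx => ⟨hx.1, ?_⟩)
    exact le_of_lt hx.2
  obtain ⟨A, hA0, hAK, hAvol⟩ := exists_matrix_norm_sq_le_and_volume hKc hKconv hε hball
  have hSfin : volume S ≠ ⊤ := by
    have hcont : Continuous (projSlice (d + 1)) := by
      unfold projSlice
      fun_prop
    exact ((measure_mono (inter_subset_right.trans (image_mono subset_closure))).trans_lt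
      (hΩb.isCompact_closure.image hcont).measure_lt_top).ne
  have hKS : projSlice (d + 1) '' K ⊆ S := by
    rintro _ ⟨x, hx, rfl⟩
    have hxΩ : x ∈ Ω := by
      by_contra hxΩ
      exact absurd (hkbdry x ⟨hx.1, by rwa [hΩo.interior_eq]⟩) (not_lt.2 hx.2)
    refine ⟨lt_of_le_of_lt ((hw1 x hxΩ).trans hx.2) ?_, x, hxΩ, rfl⟩
    rw [hk]; linarith
  have hKvol : (volume K).toReal ≤ 2 * R * a := by
    have h1 : volume K ≤ ENNReal.ofReal (2 * R) * volume S :=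
      (volume_le_mul_volume_projSlice_image (fun x hx => hΩR hx.1)).trans
        (mul_le_mul_right (measure_mono hKS) _)
    have h2 := ENNReal.toReal_mono (ENNReal.mul_ne_top ENNReal.ofReal_ne_top hSfin) h1
    rwa [ENNReal.toReal_mul, ENNReal.toReal_ofReal (by positivity)] at h2
  have hAC : 1 ≤ |A.det| * (C * a) := by
    refine hAvol.trans ?_
    calc |A.det| * N ^ (d + 1) * (volume K).toReal
        ≤ |A.det| * N ^ (d + 1) * (2 * R * a) := by gcongr
      _ = _ := by rw [hC]; ring
  have ha0 : 0 < a := by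
    by_contra! hle
    have : |A.det| * (C * a) ≤ 0 :=
      mul_nonpos_of_nonneg_of_nonpos (abs_nonneg _) (mul_nonpos_of_nonneg_of_nonpos hC0.le hle)
    linarith
  set X : ℝ := (k / N) ^ (d + 1) / (C * a) ^ 2 with hX
  have hX0 : 0 < X := by positivity
  have hXle : X ≤ (k / N) ^ (d + 1) * A.det ^ 2 := by
    have h1 : 1 ≤ (|A.det| * (C * a)) ^ 2 := one_le_pow₀ hAC
    rw [mul_pow, sq_abs] at h1
    rw [hX, div_le_iff₀ (by positivity), mul_assoc]
    exact le_mul_of_one_le_right (by positivity) h1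
  have hid : lam * (M * (a ^ (2 * p) / η ^ (N * p - 1))) * X ^ p = η := by
    have h1 : lam * M = ((2 * N) ^ (d + 1) * C ^ 2) ^ p := by rw [hM]; field_simp
    have h2 : ((2 * N) ^ (d + 1) * C ^ 2) ^ p * X ^ p = η ^ (N * p) / a ^ (2 * p) := by
      rw [← Real.mul_rpow (by positivity) hX0.le]
      have h3 : (2 * N) ^ (d + 1) * C ^ 2 * X = η ^ (d + 1) / a ^ 2 := by
        rw [hX, hk]
        simp only [div_pow, mul_pow]
        field_simp
      rw [h3, Real.div_rpow (by positivity) (by positivity), ← Real.rpow_natCast_mul hη0.le,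
        ← Real.rpow_natCast_mul ha0.le]
      norm_num [hN]
    have h4 : η ^ (N * p) = η ^ (N * p - 1) * η := by
      rw [← Real.rpow_add_one hη0.ne', sub_add_cancel]
    have h5 : 0 < η ^ (N * p - 1) := Real.rpow_pos_of_pos hη0 _
    have h6 : 0 < a ^ (2 * p) := Real.rpow_pos_of_pos ha0 _
    calc _ = (lam * M * X ^ p) * (a ^ (2 * p) / η ^ (N * p - 1)) := by ring
      _ = η := by rw [h1, h2, h4]; field_simp
  have hXp : 0 < X ^ p := Real.rpow_pos_of_pos hX0 _
  set m : ℝ := lam / 2 * X ^ p with hm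
  have hm0 : 0 < m := by positivity
  have hmlt : m < lam * ((k / N) ^ (d + 1) * A.det ^ 2) ^ p := by
    have h1 := Real.rpow_le_rpow hX0.le hXle hp.le
    calc m < lam * X ^ p := by rw [hm]; nlinarith [mul_pos hlam hXp]
      _ ≤ _ := by gcongr
  have hτt : k / m ≤ t := by
    rw [div_le_iff₀ hm0]
    have h1 : lam * (M * (a ^ (2 * p) / η ^ (N * p - 1))) * X ^ p ≤ lam * t * X ^ p := by
      gcongr
    rw [hid] at h1
    rw [hk, hm]
    linarith
  have hτ0 : 0 ≤ k / m := by positivity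
  have hlow := lower_bound_of_sublevel hn hΩo hΩb hreg hsuper hnonneg hk0 hkbdry h0
    (by rw [hu00]; exact hk0.le) A (fun x hx hxk => hAK x ⟨hx, hxk⟩) hmlt hτ0 (hτt.trans htT)
    (fun s hs => by
      have := mul_le_mul_of_nonneg_left hs.2 hm0.le
      rwa [mul_div_cancel₀ _ hm0.ne'] at this)
  rw [mul_div_cancel₀ _ hm0.ne'] at hlow
  have hmono := hreg.mono 0 (subset_closure h0) (k / m) ⟨hτ0, hτt.trans htT⟩ t ⟨ht0.le, htT⟩ hτt
  linarith
end
end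

section
/- Let u be a viscosity supersolution of u_t ≥ λ (det D²u)^p in Ω × [0,T], continuous on Ω̄ × [0,T], with u(·,0) ≥ 0 on Ω. Let h > 0, β > 0, let S′ ⊆ ℝ^{n−1} be a bounded measurable set, and for t ∈ [0,T] set S_h(t) := {x ∈ Ω : u(x,t) < h}. Assume that S_h(0) ∩ {x : x·e_n < 2β} has compact closure contained in Ω and is contained in the cylinder {x = (x′, x_n) : 0 < x_n < 2β and x′ ∈ S′}. Then there is a constant C > 0 depending only on n, p, λ, Λ such that, setting t₀ := C (β |S′|)^{2p} / h^{np−1} where |S′| is the (n−1)-dimensional Lebesgue measure of S′, if t₀ ≤ T then S_{h/4}(t₀) ⊆ {x : x·e_n > β}. -/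
open Set Metric MeasureTheory
open scoped RealInnerProductSpace

noncomputable section

variable {n : ℕ}

/-- An open bounded convex set `D` lies in a parallelepiped `{x | ∀ i, |(A (x - v)) i| ≤ 1}`
of volume comparable to that of `D`. -/
theorem exists_matrix_forall_mulVec_sub_le_one (hn : 1 ≤ n) {D : Set (Fin n → ℝ)}
    (hopen : IsOpen D) (hconv : Convex ℝ D) (hne : D.Nonempty) (hcomp : IsCompact (closure D)) :
    ∃ (v : Fin n → ℝ) (A : Matrix (Fin n) (Fin n) ℝ),
      (∀ x ∈ closure D, ∀ i, |(A.mulVec (x - v)) i| ≤ 1) ∧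
      1 ≤ |A.det| * ((n : ℝ) ^ n * (volume D).toReal) := by
  obtain ⟨v, hv⟩ := hne
  let M : (Fin n → Fin n → ℝ) → Matrix (Fin n) (Fin n) ℝ :=
    fun w => Matrix.of fun i j => w j i - v i
  have hMcont : Continuous fun w => |(M w).det| := by
    refine Continuous.abs (Continuous.matrix_det ?_)
    exact continuous_matrix fun i j => by simp only [M, Matrix.of_apply]; fun_prop
  obtain ⟨w, hwK, hmax⟩ := (isCompact_univ_pi fun _ : Fin n => hcomp).exists_isMaxOn
    ⟨fun _ => v, fun _ _ => subset_closure hv⟩ hMcont.continuousOn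
  have hwD : ∀ i, w i ∈ closure D := fun i => hwK i (mem_univ i)
  have hdet : (M w).det ≠ 0 := by
    obtain ⟨ε, hε, hball⟩ := Metric.isOpen_iff.1 hopen v hv
    have hmem : (fun j => v + Pi.single j (ε / 2)) ∈ univ.pi fun _ : Fin n => closure D := by
      intro j _
      refine subset_closure (hball ?_)
      rw [mem_ball, dist_eq_norm, add_sub_cancel_left, Pi.norm_single, Real.norm_eq_abs,
        abs_of_pos (half_pos hε)]
      exact half_lt_self hε
    have hM : M (fun j => v + Pi.single j (ε / 2)) = Matrix.diagonal fun _ => ε / 2 := by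
      ext i j
      simp [M, Matrix.diagonal_apply, Pi.single_apply]
    have hle := hmax hmem
    simp only [mem_ofPred_eq, hM, Matrix.det_diagonal, Finset.prod_const] at hle
    exact abs_pos.1 (lt_of_lt_of_le (abs_pos.2 (by positivity)) hle)
  refine ⟨v, (M w)⁻¹, fun x hx i => ?_, ?_⟩
  · have hupd : M (Function.update w i x) = (M w).updateCol i (x - v) := by
      ext a b
      by_cases hb : b = i
      · subst hb; simp [M]
      · simp [M, hb]
    have hle : |((M w).updateCol i (x - v)).det| ≤ |(M w).det| := by
      rw [← hupd]
      refine hmax fun j _ => ?_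
      by_cases hj : j = i
      · subst hj; simpa using hx
      · simpa [hj] using hwD j
    have heq : ((M w)⁻¹.mulVec (x - v)) i
        = (M w).det⁻¹ * ((M w).updateCol i (x - v)).det := by
      rw [Matrix.inv_def, Matrix.smul_mulVec, Ring.inverse_eq_inv', Pi.smul_apply,
        ← Matrix.cramer_eq_adjugate_mulVec, Matrix.cramer_apply, smul_eq_mul]
    rw [heq, abs_mul, abs_inv, inv_mul_le_iff₀ (abs_pos.2 hdet), mul_one]
    exact hle
  · have hn0 : (0 : ℝ) < n := by exact_mod_cast hn
    let B : Set (Fin n → ℝ) := Icc 0 (fun _ => (n : ℝ)⁻¹)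
    have hsub : (fun y => v + y) '' ((Matrix.toLin' (M w)) '' B) ⊆ closure D := by
      rintro _ ⟨_, ⟨c, hc, rfl⟩, rfl⟩
      have hsum : ∑ i, c i ≤ 1 := by
        calc ∑ i, c i ≤ ∑ _i : Fin n, (n : ℝ)⁻¹ := Finset.sum_le_sum fun i _ => hc.2 i
          _ = 1 := by simp [hn0.ne']
      have hcomb : v + Matrix.toLin' (M w) c = (1 - ∑ i, c i) • v + ∑ i, c i • w i := by
        ext a
        simp only [Matrix.toLin'_apply, Pi.add_apply, Matrix.mulVec, dotProduct, M,
          Matrix.of_apply, Pi.smul_apply, smul_eq_mul, Finset.sum_apply, sub_mul,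
          Finset.sum_sub_distrib, Finset.sum_mul, one_mul]
        simp only [mul_comm]
        ring
      have hconv' := hconv.closure
      have := hconv'.sum_mem (t := Finset.univ)
        (w := fun o : Option (Fin n) => o.elim (1 - ∑ i, c i) c)
        (z := fun o : Option (Fin n) => o.elim v w)
        (fun o _ => by cases o with
          | none => simpa using hsum
          | some i => exact hc.1 i)
        (by simp [Fintype.sum_option])
        (fun o _ => by cases o with
          | none => exact subset_closure hv
          | some i => exact hwD i)
      beta_reduce
      rw [hcomb]
      simpa [Fintype.sum_option] using this
    have hvolcl : volume (closure D) = volume D := by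
      refine le_antisymm ?_ (measure_mono subset_closure)
      calc volume (closure D) ≤ volume (D ∪ frontier D) :=
            measure_mono (by rw [closure_eq_self_union_frontier])
        _ ≤ volume D + volume (frontier D) := measure_union_le _ _
        _ = volume D := by rw [hconv.addHaar_frontier volume, add_zero]
    have hvol : ENNReal.ofReal |(M w).det| * ENNReal.ofReal ((n : ℝ)⁻¹) ^ n ≤ volume D := by
      have h1 := measure_mono (μ := volume) hsub
      rw [hvolcl, image_add_left, measure_preimage_add, Measure.addHaar_image_linearMap,
        LinearMap.det_toLin', Real.volume_Icc_pi] at h1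
      simpa using h1
    have hfin : volume D ≠ ⊤ := by
      rw [← hvolcl]; exact hcomp.measure_lt_top.ne
    have hreal : |(M w).det| * (n : ℝ)⁻¹ ^ n ≤ (volume D).toReal := by
      have := ENNReal.toReal_mono hfin hvol
      simpa [ENNReal.toReal_mul, ENNReal.toReal_pow] using this
    have hd : 0 < |(M w).det| := abs_pos.2 hdet
    rw [Matrix.det_nonsing_inv, Ring.inverse_eq_inv', abs_inv]
    calc (1 : ℝ) = |(M w).det|⁻¹ * ((n : ℝ) ^ n * (|(M w).det| * (n : ℝ)⁻¹ ^ n)) := by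
          rw [inv_pow]; field_simp
      _ ≤ _ := by gcongr

/-- The volume of a set contained in the cylinder over `S'` of height `b`. -/
theorem volume_toReal_le_of_subset_cylinder {m : ℕ} {D : Set (Fin (m + 1) → ℝ)} {S' : Set (E m)}
    (hb : Bornology.IsBounded S') {b : ℝ} (hb0 : 0 ≤ b)
    (hD : ∀ x ∈ D, 0 < x (Fin.last m) ∧ x (Fin.last m) < b ∧
      WithLp.toLp 2 (fun j : Fin m => x j.castSucc) ∈ S') :
    (volume D).toReal ≤ b * (volume S').toReal := by
  let e := MeasurableEquiv.piFinSuccAbove (fun _ : Fin (m + 1) => ℝ) (Fin.last m)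
  have he : MeasurePreserving e volume volume :=
    volume_preserving_piFinSuccAbove (fun _ => ℝ) (Fin.last m)
  let S : Set (Fin m → ℝ) := (MeasurableEquiv.toLp 2 (Fin m → ℝ)) ⁻¹' S'
  have hS : volume S = volume S' :=
    (PiLp.volume_preserving_toLp (Fin m)).measure_preimage_equiv S'
  have hsub : D ⊆ e ⁻¹' (Ioo 0 b ×ˢ S) := by
    intro x hx
    obtain ⟨h1, h2, h3⟩ := hD x hx
    refine ⟨⟨h1, h2⟩, ?_⟩
    have hex : (e x).2 = fun j : Fin m => x j.castSucc := by
      simp only [e, MeasurableEquiv.piFinSuccAbove_apply, Fin.insertNthEquiv_symm_apply,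
        Fin.removeNth_last]
      rfl
    change (e x).2 ∈ S
    rw [hex]
    exact h3
  have hle : volume D ≤ ENNReal.ofReal b * volume S' := by
    refine (measure_mono hsub).trans ?_
    rw [he.measure_preimage_equiv, Measure.volume_eq_prod, Measure.prod_prod, Real.volume_Ioo,
      sub_zero, hS]
  have := ENNReal.toReal_mono (ENNReal.mul_ne_top ENNReal.ofReal_ne_top hb.measure_lt_top.ne) hle
  rwa [ENNReal.toReal_mul, ENNReal.toReal_ofReal hb0] at this

/-- An affine function in `(x, t)` plus a multiple of a sum of squares in `x`. -/
def quadBarrier (k : Fin n) (A : Matrix (Fin n) (Fin n) ℝ) (v : Fin n → ℝ)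
    (a b c d : ℝ) (x : E n) (t : ℝ) : ℝ :=
  a + b * x k + c * ∑ i, (A.mulVec (x.ofLp - v) i) ^ 2 + d * t

theorem contDiff_quadBarrier (k : Fin n) (A : Matrix (Fin n) (Fin n) ℝ)
    (v : Fin n → ℝ) (a b c d : ℝ) :
    ContDiff ℝ 2 fun q : E n × ℝ => quadBarrier k A v a b c d q.1 q.2 := by
  unfold quadBarrier Matrix.mulVec dotProduct
  simp only [Pi.sub_apply]
  fun_prop

theorem isTestAt_quadBarrier (k : Fin n) (A : Matrix (Fin n) (Fin n) ℝ)
    (v : Fin n → ℝ) (a b c d : ℝ) (x : E n) (t : ℝ) :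
    IsTestAt (quadBarrier k A v a b c d) x t := by
  have h := contDiff_quadBarrier k A v a b c d
  refine ⟨1, one_pos, fun s _ => ContDiff.contDiffOn ?_, fun y _ => ContDiff.contDiffOn ?_⟩
  · exact h.comp (contDiff_id.prodMk contDiff_const)
  · exact (h.of_le one_le_two).comp (contDiff_const.prodMk contDiff_id)

theorem timeDeriv_quadBarrier (k : Fin n) (A : Matrix (Fin n) (Fin n) ℝ)
    (v : Fin n → ℝ) (a b c d : ℝ) (x : E n) (t : ℝ) :
    timeDeriv (quadBarrier k A v a b c d) x t = d := by
  have : HasDerivAt (quadBarrier k A v a b c d x) (d * 1) t :=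
    ((hasDerivAt_id t).const_mul d).const_add _
  simpa [timeDeriv] using this.deriv

theorem hessMatrix_quadBarrier (k : Fin n) (A : Matrix (Fin n) (Fin n) ℝ)
    (v : Fin n → ℝ) (a b c d : ℝ) (x : E n) (t : ℝ) :
    hessMatrix (quadBarrier k A v a b c d) x t = (2 * c) • (A.transpose * A) := by
  let L : Fin n → E n →L[ℝ] ℝ := fun i => ∑ j, A i j • EuclideanSpace.proj j
  have hL : ∀ i (y : E n), A.mulVec (y.ofLp - v) i = L i y - A.mulVec v i := by
    intro i y
    simp [L, Matrix.mulVec, dotProduct, mul_sub, Finset.sum_sub_distrib]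
  have hLs : ∀ i j, L i (EuclideanSpace.single j 1) = A i j := by
    intro i j
    simp [L]
  have hfirst : ∀ y : E n, HasFDerivAt (fun z => quadBarrier k A v a b c d z t)
      (b • (EuclideanSpace.proj k : E n →L[ℝ] ℝ) +
        c • ∑ i, (2 * (L i y - A.mulVec v i)) • L i) y := by
    intro y
    have hsq : ∀ i, HasFDerivAt (fun z : E n => (L i z - A.mulVec v i) ^ 2)
        ((2 * (L i y - A.mulVec v i)) • L i) y := by
      intro i
      simpa using (((L i).hasFDerivAt (x := y)).sub_const (A.mulVec v i)).pow 2
    have := (((((EuclideanSpace.proj k : E n →L[ℝ] ℝ).hasFDerivAt (x := y)).const_mul b).const_add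
      a).add ((HasFDerivAt.fun_sum fun i (_ : i ∈ Finset.univ) => hsq i).const_mul c)).add_const
      (d * t)
    simp only [quadBarrier, hL]
    exact this
  ext i j
  have hcomp : ∀ y : E n, fderiv ℝ (fun z => quadBarrier k A v a b c d z t) y
      (EuclideanSpace.single j (1 : ℝ)) = b * (if k = j then 1 else 0) +
        c * ∑ l, (2 * (L l y - A.mulVec v l)) * A l j := by
    intro y
    rw [(hfirst y).fderiv]
    simp [hLs]
  have hsecond : HasFDerivAt (fun y : E n => b * (if k = j then 1 else 0) +
        c * ∑ l, (2 * (L l y - A.mulVec v l)) * A l j)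
      (c • ∑ l, A l j • (2 : ℝ) • L l) x := by
    refine HasFDerivAt.const_add _ (HasFDerivAt.const_mul (HasFDerivAt.fun_sum fun l _ => ?_) c)
    exact ((((L l).hasFDerivAt (x := x)).sub_const _).const_mul 2).mul_const _
  simp only [hessMatrix, Matrix.of_apply, hcomp, hsecond.fderiv]
  simp [hLs, Matrix.mul_apply, Finset.mul_sum]
  exact Finset.sum_congr rfl fun l _ => by ring

/-- Comparison of a supersolution with a strict quadratic subsolution on a compact region. -/
theorem ViscSupersolution.quadBarrier_le {lam p T : ℝ} {Ω D : Set (E n)} {u : E n → ℝ → ℝ}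
    (hreg : ParabolicRegular Ω 0 T u) (hsup : ViscSupersolution lam p Ω 0 T u)
    (hopen : IsOpen D) (hcomp : IsCompact (closure D)) (hDΩ : closure D ⊆ Ω)
    {t₀ : ℝ} (ht₀ : 0 ≤ t₀) (htT : t₀ ≤ T)
    {k : Fin n} {A : Matrix (Fin n) (Fin n) ℝ} {v : Fin n → ℝ} {a b c d : ℝ} (hc : 0 ≤ c)
    (hstrict : d < lam * ((2 * c) ^ n * A.det ^ 2) ^ p)
    (hinit : ∀ x ∈ closure D, quadBarrier k A v a b c d x 0 ≤ u x 0)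
    (hbdry : ∀ x ∈ closure D, x ∉ D → ∀ t ∈ Icc 0 t₀, quadBarrier k A v a b c d x t ≤ u x t)
    {x : E n} (hx : x ∈ closure D) : quadBarrier k A v a b c d x t₀ ≤ u x t₀ := by
  have hcont : ContinuousOn (fun q : E n × ℝ => u q.1 q.2 - quadBarrier k A v a b c d q.1 q.2)
      (closure D ×ˢ Icc 0 t₀) :=
    (hreg.cont.mono (prod_mono (hDΩ.trans subset_closure) (Icc_subset_Icc_right htT))).sub
      (contDiff_quadBarrier k A v a b c d).continuous.continuousOn
  obtain ⟨⟨y, s⟩, ⟨hy, hs⟩, hmin⟩ := (hcomp.prod isCompact_Icc).exists_isMinOn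
    ⟨(x, t₀), hx, right_mem_Icc.2 ht₀⟩ hcont
  have hmin' : ∀ z ∈ closure D, ∀ t ∈ Icc 0 t₀,
      u y s - quadBarrier k A v a b c d y s ≤ u z t - quadBarrier k A v a b c d z t :=
    fun z hz t ht => hmin (mk_mem_prod hz ht)
  by_contra! hlt
  have hneg : u y s < quadBarrier k A v a b c d y s := by
    linarith [hmin' x hx t₀ (right_mem_Icc.2 ht₀)]
  have hyD : y ∈ D := by
    by_contra hyD
    exact hneg.not_ge (hbdry y hy hyD s hs)
  have hs0 : 0 < s := by
    refine hs.1.lt_of_ne fun h0 => ?_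
    subst h0
    exact hneg.not_ge (hinit y hy)
  obtain ⟨ε, hε, hball⟩ := Metric.isOpen_iff.1 hopen y hyD
  have hess := hessMatrix_quadBarrier k A v a b c d y s
  have hvisc := hsup y (hDΩ hy) s ⟨hs0, hs.2.trans htT⟩ _ (isTestAt_quadBarrier k A v a b c d y s)
    ⟨ε, hε, fun z _ t ht hts hz _ =>
      hmin' z (subset_closure (hball hz)) t ⟨ht.1, hts.trans hs.2⟩⟩
    (by
      rw [hess]
      simpa using (Matrix.posSemidef_conjTranspose_mul_self A).smul (by positivity : 0 ≤ 2 * c))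
  rw [hess, timeDeriv_quadBarrier, Matrix.det_smul, Matrix.det_mul, Matrix.det_transpose,
    Fintype.card_fin, ← sq] at hvisc
  exact hvisc.not_gt hstrict

/-- The barrier built from an ellipsoid of volume comparable to `V` is a strict subsolution. -/
theorem barrier_speed_lt {m : ℕ} {p lam h V δ κ : ℝ} (hn : 1 ≤ m) (hp : 0 < p) (hlam : 0 < lam)
    (hh : 0 < h) (hV : 0 < V) (hκ : 0 < κ)
    (hκδ : κ / V ^ 2 ≤ (1 / (2 * (m : ℝ))) ^ m * δ ^ 2) :
    h / (2 / (lam * κ ^ p) * V ^ (2 * p) / h ^ ((m : ℝ) * p - 1)) <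
      lam * ((2 * (h / (4 * m))) ^ m * δ ^ 2) ^ p := by
  have hm : (0 : ℝ) < m := by exact_mod_cast hn
  have hle : h ^ m * (κ / V ^ 2) ≤ (2 * (h / (4 * m))) ^ m * δ ^ 2 := by
    have : 2 * (h / (4 * m)) = h * (1 / (2 * (m : ℝ))) := by field_simp; norm_num
    rw [this, mul_pow, mul_assoc]
    gcongr
  have hpow : (h ^ m * (κ / V ^ 2)) ^ p = h ^ ((m : ℝ) * p) * (κ ^ p / V ^ (2 * p)) := by
    rw [Real.mul_rpow (by positivity) (by positivity), Real.div_rpow hκ.le (by positivity),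
      ← Real.rpow_natCast h m, ← Real.rpow_mul hh.le, ← Real.rpow_natCast V 2,
      ← Real.rpow_mul hV.le]
    norm_num
  have hhp : h ^ ((m : ℝ) * p) = h ^ ((m : ℝ) * p - 1) * h := by
    rw [Real.rpow_sub_one hh.ne']; field_simp
  have h1 : 0 < h ^ ((m : ℝ) * p - 1) := by positivity
  have h2 : 0 < V ^ (2 * p) := by positivity
  have h3 : 0 < κ ^ p := by positivity
  calc h / (2 / (lam * κ ^ p) * V ^ (2 * p) / h ^ ((m : ℝ) * p - 1))
      = (lam * (h ^ m * (κ / V ^ 2)) ^ p) / 2 := by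
        rw [hpow, hhp]; field_simp
    _ < lam * (h ^ m * (κ / V ^ 2)) ^ p := half_lt_self (by positivity)
    _ ≤ _ := by gcongr

/-- Proposition 4.1: the sublevel set `S_{h/4}` moves away from the
slab `{xₙ ≤ β}` after the time `t₀ = C (β|S'|)^{2p} / h^{np-1}`. -/
theorem stmt14 (n : ℕ) (hn : 1 ≤ n) (p lam : ℝ)
    (hp : 0 < p) (hlam : 0 < lam) :
    ∃ C : ℝ, 0 < C ∧
      ∀ (Ω : Set (E n)) (T : ℝ) (u : E n → ℝ → ℝ) (h β : ℝ) (S' : Set (E (n-1))),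
        IsOpen Ω → Convex ℝ Ω → Bornology.IsBounded Ω → 0 < T →
        ParabolicRegular Ω 0 T u →
        ViscSupersolution lam p Ω 0 T u →
        (∀ x ∈ Ω, 0 ≤ u x 0) →
        0 < h → 0 < β →
        Bornology.IsBounded S' → MeasurableSet S' →
        IsCompact (closure ({x ∈ Ω | u x 0 < h} ∩ {x : E n | x ⟨n-1, by omega⟩ < 2 * β})) →
        closure ({x ∈ Ω | u x 0 < h} ∩ {x : E n | x ⟨n-1, by omega⟩ < 2 * β}) ⊆ Ω →
        ({x ∈ Ω | u x 0 < h} ∩ {x : E n | x ⟨n-1, by omega⟩ < 2 * β} ⊆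
          {x : E n | 0 < x ⟨n-1, by omega⟩ ∧ x ⟨n-1, by omega⟩ < 2 * β ∧
            projSlice n x ∈ S'}) →
        C * (β * (volume S').toReal) ^ (2 * p) / h ^ ((n : ℝ) * p - 1) ≤ T →
        ∀ x ∈ Ω,
          u x (C * (β * (volume S').toReal) ^ (2 * p) / h ^ ((n : ℝ) * p - 1)) < h / 4 →
          β < x ⟨n-1, by omega⟩ := by
  obtain ⟨m, rfl⟩ : ∃ m, n = m + 1 := ⟨n - 1, by omega⟩
  have hm : (0 : ℝ) < ((m + 1 : ℕ) : ℝ) := by positivity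
  set κ : ℝ := (1 / (2 * ((m + 1 : ℕ) : ℝ))) ^ (m + 1) / (2 * ((m + 1 : ℕ) : ℝ) ^ (m + 1)) ^ 2
    with hκdef
  have hκ : 0 < κ := by positivity
  refine ⟨2 / (lam * κ ^ p), by positivity, ?_⟩
  intro Ω T u h β S' hΩo hΩc _ _ hreg hsup hu0 hh hβ hS'b _ hcomp hsubΩ hcyl hT x hxΩ hxu
  set t₀ := 2 / (lam * κ ^ p) * (β * (volume S').toReal) ^ (2 * p) /
    h ^ (((m + 1 : ℕ) : ℝ) * p - 1) with ht₀def
  have ht₀ : 0 ≤ t₀ := by positivity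
  let k : Fin (m + 1) := Fin.last m
  change β < x k
  set D : Set (E (m + 1)) := {x ∈ Ω | u x 0 < h} ∩ {x : E (m + 1) | x k < 2 * β} with hDdef
  have hcyl' : ∀ y ∈ D, 0 < y k ∧ y k < 2 * β ∧ projSlice (m + 1) y ∈ S' := fun y hy => hcyl hy
  by_contra! hxk
  have hT0 : (0 : ℝ) ∈ Icc 0 T := ⟨le_rfl, ht₀.trans hT⟩
  have hxD : x ∈ D := by
    refine ⟨⟨hxΩ, ?_⟩, by change x k < 2 * β; linarith⟩
    linarith [hreg.mono x (subset_closure hxΩ) 0 hT0 t₀ ⟨ht₀, hT⟩ ht₀]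
  have hucont : ContinuousOn (fun y => u y 0) (closure Ω) :=
    hreg.cont.comp (f := fun y : E (m + 1) => (y, (0 : ℝ)))
      (continuous_id.prodMk continuous_const).continuousOn fun y hy => ⟨hy, hT0⟩
  have hkcont : Continuous fun y : E (m + 1) => y k := by fun_prop
  have hDo : IsOpen D :=
    ((hucont.mono subset_closure).isOpen_inter_preimage hΩo isOpen_Iio).inter
      (isOpen_Iio.preimage hkcont)
  have hDc : Convex ℝ D :=
    (((hreg.conv 0 hT0).subset subset_closure hΩc).convex_lt h).inter
      ((convex_Iio (2 * β)).linear_preimage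
        (EuclideanSpace.proj k : E (m + 1) →L[ℝ] ℝ).toLinearMap)
  have hclk : ∀ y ∈ closure D, 0 ≤ y k ∧ y k ≤ 2 * β := fun y hy =>
    closure_minimal (t := {y : E (m + 1) | 0 ≤ y k ∧ y k ≤ 2 * β})
      (fun z hz => ⟨(hcyl' z hz).1.le, (hcyl' z hz).2.1.le⟩)
      ((isClosed_le continuous_const hkcont).inter (isClosed_le hkcont continuous_const)) hy
  let e := (EuclideanSpace.equiv (Fin (m + 1)) ℝ).symm
  let D' : Set (Fin (m + 1) → ℝ) := e ⁻¹' D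
  have hclD' : closure D' = e ⁻¹' closure D :=
    (e.toHomeomorph.preimage_closure D).symm
  obtain ⟨v, A, hA1, hA2⟩ := exists_matrix_forall_mulVec_sub_le_one hn (D := D')
    (hDo.preimage e.continuous) (hDc.linear_preimage e.toLinearEquiv.toLinearMap)
    ⟨x.ofLp, hxD⟩ (by
      rw [hclD']
      exact e.toHomeomorph.isCompact_preimage.2 hcomp)
  have hvol := volume_toReal_le_of_subset_cylinder hS'b (by positivity : 0 ≤ 2 * β)
    (D := D') fun y hy => hcyl' _ hy
  have hA : ∀ y ∈ closure D, ∑ i, (A.mulVec (y.ofLp - v) i) ^ 2 ≤ ((m + 1 : ℕ) : ℝ) := by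
    intro y hy
    calc ∑ i, (A.mulVec (y.ofLp - v) i) ^ 2 ≤ ∑ _i : Fin (m + 1), (1 : ℝ) :=
          Finset.sum_le_sum fun i _ => (sq_le_one_iff_abs_le_one _).2
            (hA1 y.ofLp (by rw [hclD']; exact hy) i)
      _ = _ := by simp
  set V := β * (volume S').toReal with hVdef
  have hAV : 1 ≤ |A.det| * (2 * ((m + 1 : ℕ) : ℝ) ^ (m + 1) * V) := by
    refine hA2.trans ?_
    calc _ ≤ |A.det| * (((m + 1 : ℕ) : ℝ) ^ (m + 1) * (2 * β * (volume S').toReal)) := by gcongr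
      _ = _ := by rw [hVdef]; ring
  have hV : 0 < V := by
    refine (by positivity : 0 ≤ V).lt_of_ne fun h0 => ?_
    rw [← h0, mul_zero, mul_zero] at hAV
    exact absurd hAV (by norm_num)
  have hκV : κ / V ^ 2 ≤ (1 / (2 * ((m + 1 : ℕ) : ℝ))) ^ (m + 1) * A.det ^ 2 := by
    have hsq : 1 ≤ A.det ^ 2 * (2 * ((m + 1 : ℕ) : ℝ) ^ (m + 1) * V) ^ 2 := by
      rw [← sq_abs A.det, ← mul_pow]
      exact one_le_pow₀ hAV
    rw [hκdef, div_div, ← mul_pow, div_le_iff₀ (by positivity), mul_assoc]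
    exact le_mul_of_one_le_right (by positivity) hsq
  have ht₀pos : 0 < t₀ := by positivity
  have hstrict := barrier_speed_lt hn hp hlam hh hV hκ hκV
  rw [← ht₀def] at hstrict
  have hbarrier : ∀ y ∈ closure D, ∀ t ≤ t₀,
      quadBarrier k A v (-h / 4) (-(h / (2 * β))) (h / (4 * (m + 1 : ℕ))) (h / t₀) y t ≤
        h / t₀ * t - h * (y k / (2 * β)) := by
    intro y hy t _
    have h1 : h / (4 * (m + 1 : ℕ)) * ∑ i, (A.mulVec (y.ofLp - v) i) ^ 2 ≤ h / 4 := by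
      calc _ ≤ h / (4 * (m + 1 : ℕ)) * ((m + 1 : ℕ) : ℝ) := by gcongr; exact hA y hy
        _ = h / 4 := by field_simp
    have h2 : -(h / (2 * β)) * y k = -(h * (y k / (2 * β))) := by ring
    unfold quadBarrier
    linarith
  have htime : ∀ t ≤ t₀, h / t₀ * t ≤ h := fun t ht => by
    calc h / t₀ * t ≤ h / t₀ * t₀ := by gcongr
      _ = h := by field_simp
  have hkey := hsup.quadBarrier_le hreg hDo hcomp hsubΩ ht₀ hT (k := k) (v := v)
    (a := -h / 4) (b := -(h / (2 * β))) (by positivity) hstrict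
    (fun y hy => by
      have := hbarrier y hy 0 ht₀
      have h1 : 0 ≤ h * (y k / (2 * β)) :=
        mul_nonneg hh.le (div_nonneg (hclk y hy).1 (by positivity))
      linarith [hu0 y (hsubΩ hy)])
    (fun y hy hyD t ht => by
      have hb := hbarrier y hy t ht.2
      have h1 : 0 ≤ h * (y k / (2 * β)) :=
        mul_nonneg hh.le (div_nonneg (hclk y hy).1 (by positivity))
      have hmono := hreg.mono y (subset_closure (hsubΩ hy)) 0 hT0 t ⟨ht.1, ht.2.trans hT⟩ ht.1
      have h2 := htime t ht.2
      by_cases hyu : u y 0 < h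
      · have hyk : 2 * β ≤ y k := not_lt.1 fun hlt => hyD ⟨⟨hsubΩ hy, hyu⟩, hlt⟩
        have h3 : h * 1 ≤ h * (y k / (2 * β)) := by
          gcongr
          rwa [one_le_div (by positivity)]
        linarith [hu0 y (hsubΩ hy)]
      · linarith)
    (subset_closure hxD)
  have hlow : h / 4 ≤
      quadBarrier k A v (-h / 4) (-(h / (2 * β))) (h / (4 * (m + 1 : ℕ))) (h / t₀) x t₀ := by
    have h1 : 0 ≤ h / (4 * (m + 1 : ℕ)) * ∑ i, (A.mulVec (x.ofLp - v) i) ^ 2 := by positivity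
    have h2 : h / t₀ * t₀ = h := by field_simp
    have h3 : h / (2 * β) * x k ≤ h / 2 := by
      calc h / (2 * β) * x k ≤ h / (2 * β) * β := by gcongr
        _ = h / 2 := by field_simp
    unfold quadBarrier
    linarith
  linarith
end
end

section
/- Let u be continuous on B̄₁ × [−1,0] ⊂ ℝⁿ × ℝ, convex in x for each fixed t and nondecreasing in t for each fixed x, and a viscosity subsolution of u_t ≤ Λ (det D²u)^p in B₁ × (−1,0]. If u(0,0) ≥ −1 and u(x,0) ≤ 0 for all x ∈ ∂B₁, then there exists a constant c ∈ (0,1] depending only on n, Λ, p such that u(0,t) ≥ −2 for all t ∈ [−c, 0]. -/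
open Set Metric MeasureTheory
open scoped RealInnerProductSpace

noncomputable section

variable {n : ℕ}

/-- The paraboloid barrier `2|x|² - 3/2 + K (t + c)`. -/
def paraboloid (n : ℕ) (K c : ℝ) (x : E n) (t : ℝ) : ℝ :=
  2 * ‖x‖ ^ 2 + (-(3 / 2) + K * (t + c))

theorem isTestAt_paraboloid (K c : ℝ) (x₀ : E n) (t₀ : ℝ) :
    IsTestAt (paraboloid n K c) x₀ t₀ := by
  refine ⟨1, one_pos, fun t _ => ?_, fun x _ => ?_⟩
  · exact ((contDiff_const.mul (contDiff_norm_sq ℝ)).add contDiff_const).contDiffOn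
  · unfold paraboloid
    exact ContDiff.contDiffOn (by fun_prop)

theorem timeDeriv_paraboloid (K c : ℝ) (x : E n) (t : ℝ) :
    timeDeriv (paraboloid n K c) x t = K := by
  have h : HasDerivAt (fun t => paraboloid n K c x t) (K * 1) t :=
    ((((hasDerivAt_id t).add_const c).const_mul K).const_add (-(3 / 2))).const_add (2 * ‖x‖ ^ 2)
  simpa [timeDeriv] using h.deriv

theorem hessMatrix_paraboloid (K c : ℝ) (x : E n) (t : ℝ) :
    hessMatrix (paraboloid n K c) x t = Matrix.diagonal fun _ => (4 : ℝ) := by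
  have hgrad : ∀ (y : E n) (j : Fin n),
      fderiv ℝ (fun z => paraboloid n K c z t) y (EuclideanSpace.single j (1 : ℝ)) = 4 * y j := by
    intro y j
    have h := (((hasStrictFDerivAt_norm_sq y).hasFDerivAt).const_mul 2).add_const
      (-(3 / 2) + K * (t + c))
    rw [show (fun z => paraboloid n K c z t) =
      fun z : E n => 2 * ‖z‖ ^ 2 + (-(3 / 2) + K * (t + c)) from rfl, h.fderiv]
    simp [EuclideanSpace.inner_single_right]
    ring
  ext i j
  have h : HasFDerivAt (fun y : E n => 4 * y j)
      ((4 : ℝ) • (EuclideanSpace.proj j : E n →L[ℝ] ℝ)) x :=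
    ((EuclideanSpace.proj j : E n →L[ℝ] ℝ).hasFDerivAt).const_mul 4
  simp only [hessMatrix, Matrix.of_apply, hgrad]
  rw [h.fderiv]
  by_cases hij : i = j
  · subst hij
    simp
  · simp [Matrix.diagonal_apply_ne _ hij, Ne.symm hij]

/-- A convex function that is at most `a` at the centre and nonpositive on the unit sphere
lies below the cone with vertex value `a`. -/
theorem ConvexOn.le_cone {f : E n → ℝ} (hf : ConvexOn ℝ (closedBall (0 : E n) 1) f) {a : ℝ}
    (h0 : f 0 ≤ a) (h1 : ∀ x ∈ sphere (0 : E n) 1, f x ≤ 0) {x : E n}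
    (hx : x ∈ closedBall (0 : E n) 1) : f x ≤ a * (1 - ‖x‖) := by
  rcases eq_or_ne x 0 with rfl | hne
  · simpa using h0
  have hr : ‖x‖ ≠ 0 := norm_ne_zero_iff.2 hne
  have hr1 : ‖x‖ ≤ 1 := by simpa using hx
  have hy : ‖x‖⁻¹ • x ∈ sphere (0 : E n) 1 := by
    simp [norm_smul, hr]
  have h := hf.2 (mem_closedBall_self zero_le_one) (sphere_subset_closedBall hy)
    (sub_nonneg.2 hr1) (norm_nonneg x) (by ring)
  rw [smul_zero, zero_add, smul_inv_smul₀ hr] at h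
  simp only [smul_eq_mul] at h
  nlinarith [mul_le_mul_of_nonneg_left h0 (sub_nonneg.2 hr1),
    mul_nonneg (norm_nonneg x) (neg_nonneg.2 (h1 _ hy))]

/-- Lemma 3.1: a pointwise lower bound backwards in time for subsolutions. -/
theorem stmt15 (n : ℕ) (hn : 1 ≤ n) (p Lam : ℝ) (hp : 0 < p) (hLam : 0 < Lam) :
    ∃ c : ℝ, 0 < c ∧ c ≤ 1 ∧
      ∀ u : E n → ℝ → ℝ,
        ParabolicRegular (ball (0 : E n) 1) (-1) 0 u →
        ViscSubsolution Lam p (ball (0 : E n) 1) (-1) 0 u →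
        -1 ≤ u 0 0 →
        (∀ x ∈ sphere (0 : E n) 1, u x 0 ≤ 0) →
        ∀ t ∈ Icc (-c) 0, -2 ≤ u 0 t := by
  set K : ℝ := Lam * ((4 : ℝ) ^ n) ^ p + 1 with hK
  have hK1 : 1 ≤ K := by
    have : 0 ≤ Lam * ((4 : ℝ) ^ n) ^ p := by positivity
    linarith
  have hK0 : 0 < K := by linarith
  have hc0 : 0 < 1 / (4 * K) := by positivity
  have hc1 : 1 / (4 * K) ≤ 1 := by
    rw [div_le_one (by positivity)]
    linarith
  have hKc : K * (1 / (4 * K)) = 1 / 4 := by field_simp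
  refine ⟨1 / (4 * K), hc0, hc1, ?_⟩
  generalize 1 / (4 * K) = c at hc0 hc1 hKc
  intro u hreg hsub hu0 hbd t ht
  by_contra! hlt
  have hcl : closure (ball (0 : E n) 1) = closedBall 0 1 := closure_ball _ one_ne_zero
  obtain ⟨hcont, hconv, hmono⟩ := hreg
  rw [hcl] at hcont hconv hmono
  have hIcc : Icc (-c) 0 ⊆ Icc (-1 : ℝ) 0 := Icc_subset_Icc (by linarith) le_rfl
  have hcI : -c ∈ Icc (-1 : ℝ) 0 := hIcc ⟨le_rfl, by linarith⟩
  have h0I : (0 : ℝ) ∈ Icc (-1 : ℝ) 0 := ⟨by norm_num, le_rfl⟩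
  have hside : ∀ x ∈ sphere (0 : E n) 1, ∀ s ∈ Icc (-1 : ℝ) 0, u x s ≤ 0 := fun x hx s hs =>
    (hmono x (sphere_subset_closedBall hx) s hs 0 h0I hs.2).trans (hbd x hx)
  have hbottom : ∀ x ∈ closedBall (0 : E n) 1, u x (-c) ≤ -2 * (1 - ‖x‖) := fun x hx =>
    (hconv (-c) hcI).le_cone
      ((hmono 0 (mem_closedBall_self zero_le_one) _ hcI t (hIcc ht) ht.1).trans hlt.le)
      (fun y hy => hside y hy _ hcI) hx
  have hφcont : Continuous fun q : E n × ℝ => paraboloid n K c q.1 q.2 := by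
    unfold paraboloid
    fun_prop
  obtain ⟨⟨x₁, t₁⟩, ⟨hx₁, ht₁⟩, hmax⟩ :=
    ((isCompact_closedBall (0 : E n) 1).prod (isCompact_Icc (a := -c) (b := 0))).exists_isMaxOn
      ⟨(0, 0), mem_closedBall_self zero_le_one, by linarith, le_rfl⟩
      ((hcont.mono (prod_mono subset_rfl hIcc)).sub hφcont.continuousOn)
  have hmax' : ∀ x ∈ closedBall (0 : E n) 1, ∀ s ∈ Icc (-c) 0,
      u x s - paraboloid n K c x s ≤ u x₁ t₁ - paraboloid n K c x₁ t₁ :=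
    fun x hx s hs => hmax (a := (x, s)) ⟨hx, hs⟩
  simp only at hx₁ ht₁
  have hpos : 0 < u x₁ t₁ - paraboloid n K c x₁ t₁ := by
    have h := hmax' 0 (mem_closedBall_self zero_le_one) 0 ⟨by linarith, le_rfl⟩
    simp only [paraboloid, norm_zero] at h ⊢
    linarith
  have htime : -c < t₁ := by
    refine lt_of_le_of_ne ht₁.1 fun h => ?_
    subst h
    have := hbottom x₁ hx₁
    simp only [paraboloid] at hpos
    nlinarith [sq_nonneg (2 * ‖x₁‖ - 1)]
  have hspace : x₁ ∈ ball (0 : E n) 1 := by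
    rcases lt_or_eq_of_le (mem_closedBall.1 hx₁) with h | h
    · exact h
    have h1 : ‖x₁‖ = 1 := by simpa using h
    have := hside x₁ h t₁ (hIcc ht₁)
    have := mul_nonneg hK0.le (by linarith : 0 ≤ t₁ + c)
    simp only [paraboloid, h1] at hpos
    linarith
  have hvisc := hsub x₁ hspace t₁ ⟨by linarith, ht₁.2⟩ _ (isTestAt_paraboloid K c x₁ t₁)
    ⟨t₁ + c, by linarith, fun x hx s hs hst _ hd => hmax' x (hcl ▸ hx) s
      ⟨by linarith [(abs_lt.1 (Real.dist_eq s t₁ ▸ hd)).1], hs.2⟩⟩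
  rw [timeDeriv_paraboloid, hessMatrix_paraboloid, Matrix.det_diagonal, Finset.prod_const,
    Finset.card_univ, Fintype.card_fin, max_eq_left (by positivity)] at hvisc
  linarith
end
end
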